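/- Case 5 of Theorem 1.2: the hypergeometric group Γ(f,g) generated by the companion matrices A and B of f(x) = x^5 - 4x^4 + 7x^3 - 7x^2 + 4x - 1 and g(x) = x^5 + x^4 + 2x^3 + 2x^2 + x + 1 is an arithmetic subgroup of the integral orthogonal group O_Q(ℤ): Γ(f,g) is contained in O_Q(ℤ) (in particular Aᵀ·Q·A = Q and Bᵀ·Q·B = Q), and Γ(f,g) has finite index in O_Q(ℤ). -/

import Mathlib

open Matrix

/-- The companion matrix `A` of `f(x) = x^5 - 4*x^4 + 7*x^3 - 7*x^2 + 4*x - 1`. -/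
def matA : Matrix (Fin 5) (Fin 5) ℤ :=
  !![(0 : ℤ), 0, 0, 0, 1; 1, 0, 0, 0, -4; 0, 1, 0, 0, 7; 0, 0, 1, 0, -7; 0, 0, 0, 1, 4]

/-- The companion matrix `B` of `g(x) = x^5 + x^4 + 2*x^3 + 2*x^2 + x + 1`. -/
def matB : Matrix (Fin 5) (Fin 5) ℤ :=
  !![(0 : ℤ), 0, 0, 0, -1; 1, 0, 0, 0, -1; 0, 1, 0, 0, -2; 0, 0, 1, 0, -2; 0, 0, 0, 1, -1]

/-- The symmetric integer matrix `Q` of the quadratic form preserved by `Γ(f,g)`. -/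
def matQ : Matrix (Fin 5) (Fin 5) ℤ :=
  !![(37 : ℤ), 11, -35, -37, 37; 11, 37, 11, -35, -37; -35, 11, 37, 11, -35; -37, -35, 11, 37, 11; 37, -37, -35, 11, 37]

/-- The integral orthogonal group `O_Q(ℤ)` of a matrix `Q`, as the subgroup of `GL₅(ℤ)`
consisting of all `M` with `Mᵀ * Q * M = Q`. -/
def orthogonalSubgroup (Q : Matrix (Fin 5) (Fin 5) ℤ) : Subgroup (GL (Fin 5) ℤ) where
  carrier := { M : GL (Fin 5) ℤ |
      (M : Matrix (Fin 5) (Fin 5) ℤ)ᵀ * Q * (M : Matrix (Fin 5) (Fin 5) ℤ) = Q }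
  one_mem' := by simp
  mul_mem' := by
    intro a b ha hb
    simp only [Set.mem_setOf_eq, Units.val_mul, transpose_mul] at ha hb ⊢
    calc ((b : Matrix (Fin 5) (Fin 5) ℤ)ᵀ * (a : Matrix (Fin 5) (Fin 5) ℤ)ᵀ) * Q *
          ((a : Matrix (Fin 5) (Fin 5) ℤ) * (b : Matrix (Fin 5) (Fin 5) ℤ))
        = (b : Matrix (Fin 5) (Fin 5) ℤ)ᵀ *
            ((a : Matrix (Fin 5) (Fin 5) ℤ)ᵀ * Q * (a : Matrix (Fin 5) (Fin 5) ℤ)) *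
            (b : Matrix (Fin 5) (Fin 5) ℤ) := by
          simp only [mul_assoc]
      _ = Q := by rw [ha, hb]
  inv_mem' := by
    intro a ha
    simp only [Set.mem_setOf_eq] at ha ⊢
    calc ((a⁻¹ : GL (Fin 5) ℤ) : Matrix (Fin 5) (Fin 5) ℤ)ᵀ * Q *
          ((a⁻¹ : GL (Fin 5) ℤ) : Matrix (Fin 5) (Fin 5) ℤ)
        = ((a⁻¹ : GL (Fin 5) ℤ) : Matrix (Fin 5) (Fin 5) ℤ)ᵀ *
            ((a : Matrix (Fin 5) (Fin 5) ℤ)ᵀ * Q * (a : Matrix (Fin 5) (Fin 5) ℤ)) *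
            ((a⁻¹ : GL (Fin 5) ℤ) : Matrix (Fin 5) (Fin 5) ℤ) := by rw [ha]
      _ = ((a : Matrix (Fin 5) (Fin 5) ℤ) *
            ((a⁻¹ : GL (Fin 5) ℤ) : Matrix (Fin 5) (Fin 5) ℤ))ᵀ * Q *
          ((a : Matrix (Fin 5) (Fin 5) ℤ) *
            ((a⁻¹ : GL (Fin 5) ℤ) : Matrix (Fin 5) (Fin 5) ℤ)) := by
          simp only [transpose_mul, mul_assoc]
      _ = Q := by rw [Units.mul_inv]; simp


/-- A predicate on coordinate vectors which is stable under the elementary moves with parameter in `N ℤ`. -/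
structure Moves (N : ℤ) (T : ℤ → ℤ → ℤ → ℤ → ℤ → Prop) : Prop where
  base : T 1 0 0 0 0
  ep : ∀ s α a c b β, N ∣ s → T (α - s * b) (a + s * β) c b β → T α a c b β
  eq : ∀ s α a c b β, N ∣ s → T (α - s * a) a c (b + s * β) β → T α a c b β
  ez : ∀ s α a c b β, N ∣ s → T (α - 2 * s * c - s ^ 2 * β) a (c + s * β) b β → T α a c b β
  fp : ∀ s α a c b β, N ∣ s → T α (a + s * α) c b (β - s * b) → T α a c b β
  fq : ∀ s α a c b β, N ∣ s → T α a c (b + s * α) (β - s * a) → T α a c b β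
  fz : ∀ s α a c b β, N ∣ s → T α a (c + s * α) b (β - 2 * s * c - s ^ 2 * α) → T α a c b β

lemma Moves.last {N : ℤ} {T : ℤ → ℤ → ℤ → ℤ → ℤ → Prop} (h : Moves N T) (a c b β : ℤ)
    (hf : β + a * b + c ^ 2 = 0) (ha : N ∣ a) (hb : N ∣ b) (hc : N ∣ c) : T 1 a c b β := by
  apply h.fp (-a) _ _ _ _ _ (by simpa using ha)
  apply h.fq (-b) _ _ _ _ _ (by simpa using hb)
  apply h.fz (-c) _ _ _ _ _ (by simpa using hc)
  have e1 : a + -a * 1 = 0 := by ring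
  have e2 : b + -b * 1 = 0 := by ring
  have e3 : c + -c * 1 = 0 := by ring
  have e4 : β - -a * b - -b * (a + -a * 1) - 2 * -c * c - (-c) ^ 2 * 1 = 0 := by linarith
  rw [e4, e1, e2, e3]
  exact h.base

lemma Moves.split {N : ℤ} {T : ℤ → ℤ → ℤ → ℤ → ℤ → Prop} (h : Moves N T) (α ε x y : ℤ)
    (hα : N ^ 2 ∣ α - 1) (hε : ε * ε = 1) (hxy : IsCoprime x y) :
    T α (N * (ε * x ^ 2)) (N * (ε * (x * y))) (N * (-(ε * y ^ 2))) 0 := by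
  obtain ⟨u, v, huv⟩ := hxy.pow (m := 2) (n := 2)
  obtain ⟨k, hk⟩ := hα
  apply h.ep (N * (-(k * ε * v))) _ _ _ _ _ (Dvd.intro _ rfl)
  apply h.eq (N * (k * ε * u)) _ _ _ _ _ (Dvd.intro _ rfl)
  have e : α - N * (-(k * ε * v)) * (N * (-(ε * y ^ 2)))
      - N * (k * ε * u) * (N * (ε * x ^ 2) + N * (-(k * ε * v)) * 0) = 1 := by
    have : α - N * (-(k * ε * v)) * (N * (-(ε * y ^ 2)))
      - N * (k * ε * u) * (N * (ε * x ^ 2) + N * (-(k * ε * v)) * 0)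
      = α - N ^ 2 * k * (ε * ε) * (u * x ^ 2 + v * y ^ 2) := by ring
    rw [this, hε, huv]; linarith
  rw [e]
  apply h.last
  · linear_combination (0 : ℤ) * hε
  · simp
  · simp
  · simp

lemma sq_or_neg_sq {p : ℕ} [Fact p.Prime] (hp : p % 4 = 3) (z : ZMod p) :
    ∃ y : ZMod p, y * y = z ∨ y * y = -z := by
  classical
  by_cases hz : z = 0
  · exact ⟨0, by simp [hz]⟩
  by_cases h : IsSquare z
  · obtain ⟨y, hy⟩ := h
    exact ⟨y, Or.inl hy.symm⟩
  · have h1 : quadraticChar (ZMod p) z = -1 := quadraticChar_neg_one_iff_not_isSquare.2 h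
    have h2 : quadraticChar (ZMod p) (-1) = -1 := by
      rw [quadraticChar_neg_one_iff_not_isSquare, ZMod.exists_sq_eq_neg_one_iff]
      simpa using hp
    have h3 : quadraticChar (ZMod p) (-z) = 1 := by
      rw [← neg_one_mul, map_mul, h1, h2]; norm_num
    rw [quadraticChar_one_iff_isSquare (by simpa using hz)] at h3
    obtain ⟨y, hy⟩ := h3
    exact ⟨y, Or.inr hy.symm⟩

lemma Moves.prime {N : ℤ} (hN : 4 ∣ N) {T : ℤ → ℤ → ℤ → ℤ → ℤ → Prop} (h : Moves N T)
    (p : ℕ) (hp : p.Prime) (a c b β : ℤ) (hpN : N ^ 2 ∣ (p : ℤ) + 1) (hpb : ¬ (p : ℤ) ∣ b)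
    (hf : -(p : ℤ) * β + a * b + c ^ 2 = 0) (ha : N ∣ a) (hb : N ∣ b) (hc : N ∣ c) :
    T (-p) a c b β := by
  have := Fact.mk hp
  have hp4 : p % 4 = 3 := by
    have : (4 : ℤ) ∣ (p : ℤ) + 1 := (hN.trans (dvd_pow_self N two_ne_zero)).trans hpN
    omega
  have hpN' : ¬ (p : ℤ) ∣ N := by
    intro hd
    have h1 : (p : ℤ) ∣ p + 1 := (hd.trans (dvd_pow_self N two_ne_zero)).trans hpN
    have h2 : (p : ℤ) ∣ 1 := by simpa using h1
    have := Int.natCast_dvd_natCast.1 (by simpa using h2 : (p : ℤ) ∣ ((1 : ℕ) : ℤ))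
    exact hp.one_lt.ne' (Nat.dvd_one.1 this)
  obtain ⟨a0, rfl⟩ := ha
  obtain ⟨b0, rfl⟩ := hb
  obtain ⟨c0, rfl⟩ := hc
  have hpp : Prime (p : ℤ) := Nat.prime_iff_prime_int.1 hp
  have hb0 : ¬ (p : ℤ) ∣ b0 := fun hd => hpb (hd.mul_left N)
  have hq : (p : ℤ) ∣ a0 * b0 + c0 ^ 2 := by
    have : (p : ℤ) ∣ N ^ 2 * (a0 * b0 + c0 ^ 2) := ⟨β, by linear_combination hf⟩
    rcases hpp.dvd_or_dvd this with h1 | h1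
    · exact absurd (hpp.dvd_of_dvd_pow h1) hpN'
    · exact h1
  have hqz : (a0 : ZMod p) * b0 + c0 ^ 2 = 0 := by
    have := (ZMod.intCast_zmod_eq_zero_iff_dvd _ p).2 hq
    push_cast at this; exact this
  have hbz : (b0 : ZMod p) ≠ 0 := fun h0 => hb0 ((ZMod.intCast_zmod_eq_zero_iff_dvd _ p).1 h0)
  obtain ⟨y, ε, hε, hy⟩ : ∃ y : ZMod p, ∃ ε : ℤ, ε * ε = 1 ∧ y * y = -((ε : ZMod p) * b0) := by
    obtain ⟨y, hy | hy⟩ := sq_or_neg_sq hp4 (b0 : ZMod p)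
    · exact ⟨y, -1, by norm_num, by simp [hy]⟩
    · exact ⟨y, 1, by norm_num, by simp [hy]⟩
  have hεz : (ε : ZMod p) * ε = 1 := by exact_mod_cast congrArg (Int.cast : ℤ → ZMod p) hε
  have hy0 : y ≠ 0 := by
    rintro rfl
    apply hbz
    have : (ε : ZMod p) * (ε * b0) = 0 := by
      have : (ε : ZMod p) * b0 = 0 := by simpa using hy.symm
      rw [this, mul_zero]
    rwa [← mul_assoc, hεz, one_mul] at this
  set Y : ℤ := (y.val : ℤ) with hY
  have hYz : (Y : ZMod p) = y := by simp [hY]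
  have hYp : ¬ (p : ℤ) ∣ Y := fun hd => hy0 (hYz ▸ (ZMod.intCast_zmod_eq_zero_iff_dvd _ p).2 hd)
  have hcop : IsCoprime (p : ℤ) Y := (Prime.coprime_iff_not_dvd hpp).2 hYp
  set x0 : ℤ := (((ε : ZMod p) * c0 * y⁻¹).val : ℤ) with hx0
  have hx0z : (x0 : ZMod p) = (ε : ZMod p) * c0 * y⁻¹ := by simp [hx0]
  obtain ⟨u, v, huv⟩ := hcop
  set X : ℤ := x0 + p * (u * (1 - x0)) with hX
  have hXz : (X : ZMod p) = (ε : ZMod p) * c0 * y⁻¹ := by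
    rw [hX]; push_cast; rw [hx0z]; simp
  have hXY : IsCoprime X Y := by
    refine ⟨1, v * (1 - x0), ?_⟩
    rw [hX]; linear_combination (1 - x0) * huv
  have d1 : (p : ℤ) ∣ a0 - ε * X ^ 2 := by
    rw [← ZMod.intCast_zmod_eq_zero_iff_dvd]
    push_cast
    rw [hXz]
    have : ((a0 : ZMod p) - ε * ((ε : ZMod p) * c0 * y⁻¹) ^ 2) * (y * y) = 0 := by
      have e1 : ((a0 : ZMod p) - ε * ((ε : ZMod p) * c0 * y⁻¹) ^ 2) * (y * y)
        = a0 * (y * y) - ε * (ε * ε) * c0 ^ 2 * (y * y⁻¹) ^ 2 := by ring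
      rw [e1, mul_inv_cancel₀ hy0, hεz, hy]
      linear_combination (-(ε : ZMod p)) * hqz
    rcases mul_eq_zero.1 this with h1 | h1
    · exact h1
    · exact absurd h1 (mul_ne_zero hy0 hy0)
  have d2 : (p : ℤ) ∣ c0 - ε * (X * Y) := by
    rw [← ZMod.intCast_zmod_eq_zero_iff_dvd]
    push_cast
    rw [hXz, hYz]
    have e1 : (c0 : ZMod p) - ε * (ε * c0 * y⁻¹ * y) = c0 - (ε * ε) * c0 * (y * y⁻¹) := by ring
    rw [e1, hεz, mul_inv_cancel₀ hy0]; ring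
  have d3 : (p : ℤ) ∣ b0 - -(ε * Y ^ 2) := by
    rw [← ZMod.intCast_zmod_eq_zero_iff_dvd]
    push_cast
    rw [hYz, pow_two, hy]
    linear_combination (-(b0 : ZMod p)) * hεz
  obtain ⟨s1, hs1⟩ := d1
  obtain ⟨s2, hs2⟩ := d2
  obtain ⟨s3, hs3⟩ := d3
  apply h.fp (N * s1) _ _ _ _ _ (Dvd.intro _ rfl)
  apply h.fq (N * s3) _ _ _ _ _ (Dvd.intro _ rfl)
  apply h.fz (N * s2) _ _ _ _ _ (Dvd.intro _ rfl)
  have e1 : N * a0 + N * s1 * -(p : ℤ) = N * (ε * X ^ 2) := by linear_combination N * hs1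
  have e2 : N * c0 + N * s2 * -(p : ℤ) = N * (ε * (X * Y)) := by linear_combination N * hs2
  have e3 : N * b0 + N * s3 * -(p : ℤ) = N * (-(ε * Y ^ 2)) := by linear_combination N * hs3
  have e4 : β - N * s1 * (N * b0) - N * s3 * (N * a0 + N * s1 * -(p : ℤ)) - 2 * (N * s2) * (N * c0)
      - (N * s2) ^ 2 * -(p : ℤ) = 0 := by
    set β' := β - N * s1 * (N * b0) - N * s3 * (N * a0 + N * s1 * -(p : ℤ)) - 2 * (N * s2) * (N * c0)
      - (N * s2) ^ 2 * -(p : ℤ) with hβ'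
    have : -(p : ℤ) * β' + (N * a0 + N * s1 * -(p : ℤ)) * (N * b0 + N * s3 * -(p : ℤ))
        + (N * c0 + N * s2 * -(p : ℤ)) ^ 2 = 0 := by
      rw [hβ']; linear_combination hf
    rw [e1, e2, e3] at this
    have h2 : -(p : ℤ) * β' = 0 := by linear_combination this
    rcases mul_eq_zero.1 h2 with h3 | h3
    · exact absurd (neg_eq_zero.1 h3) hpp.ne_zero
    · exact h3
  rw [e4, e1, e2, e3]
  refine h.split _ _ _ _ ?_ hε hXY
  have : -(p : ℤ) - 1 = -(p + 1) := by ring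
  rw [this]; exact (dvd_neg).2 hpN

lemma Moves.coprime {N : ℤ} (hN : 4 ∣ N) (hN0 : N ≠ 0) {T : ℤ → ℤ → ℤ → ℤ → ℤ → Prop}
    (h : Moves N T) (α a c b β : ℤ) (hα : N ^ 2 ∣ α - 1) (hb0 : b ≠ 0) (hαb : IsCoprime α b)
    (hf : α * β + a * b + c ^ 2 = 0) (ha : N ∣ a) (hb : N ∣ b) (hc : N ∣ c) :
    T α a c b β := by
  have hαN : IsCoprime α N := by
    obtain ⟨k, hk⟩ := hα
    exact ⟨1, -(N * k), by linear_combination hk⟩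
  have hq0 : (N * b).natAbs ≠ 0 := by simp [hN0, hb0]
  have hcop : IsCoprime (-α) ((N * b).natAbs : ℤ) := by
    have : IsCoprime (-α) (N * b) := (hαN.mul_right hαb).neg_left
    rcases Int.natAbs_eq (N * b) with h1 | h1
    · rwa [h1] at this
    · rw [h1] at this; exact (IsCoprime.neg_right_iff _ _).1 this
  obtain ⟨p, hpb, hp, hmod⟩ := Nat.forall_exists_prime_gt_and_zmodEq b.natAbs hq0 hcop
  have hd : N * b ∣ -α - p := by
    have := hmod.dvd
    exact (Int.natAbs_dvd.1 this)
  obtain ⟨k, hk⟩ := hd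
  apply h.ep (-(N * k)) _ _ _ _ _ (by simp)
  have e1 : α - -(N * k) * b = -p := by linear_combination -hk
  rw [e1]
  refine h.prime hN p hp _ _ _ _ ?_ ?_ ?_ ?_ hb hc
  · obtain ⟨b1, rfl⟩ := hb
    obtain ⟨j, hj⟩ := hα
    exact ⟨-j - b1 * k, by linear_combination -hj - hk⟩
  · intro hd
    have := Int.le_of_dvd (by positivity) ((dvd_abs _ _).2 hd)
    rw [Int.abs_eq_natAbs] at this
    omega
  · linear_combination hf - β * e1
  · exact dvd_add ha (by simp [mul_assoc])

lemma exists_sep (b α : ℤ) (hb : b ≠ 0) :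
    ∃ r : ℤ, ∀ p : ℤ, Prime p → p ∣ b → (p ∣ r ↔ ¬ p ∣ α) := by
  classical
  refine ⟨∏ q ∈ b.natAbs.primeFactors.filter (fun q : ℕ => ¬ (q : ℤ) ∣ α), (q : ℤ), ?_⟩
  intro p hp hpb
  have hpn : p.natAbs.Prime := Int.prime_iff_natAbs_prime.1 hp
  constructor
  · intro hd
    rw [hp.dvd_finsetProd_iff] at hd
    obtain ⟨q, hq, hpq⟩ := hd
    rw [Finset.mem_filter, Nat.mem_primeFactors] at hq
    have h1 : p.natAbs ∣ q := by simpa using Int.natAbs_dvd_natAbs.2 hpq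
    have h2 : p.natAbs = q := (Nat.prime_dvd_prime_iff_eq hpn hq.1.1).1 h1
    have h3 := hq.2
    rw [← h2, Int.natAbs_dvd] at h3
    exact h3
  · intro hd
    have : p.natAbs ∈ b.natAbs.primeFactors.filter (fun q : ℕ => ¬ (q : ℤ) ∣ α) := by
      rw [Finset.mem_filter, Nat.mem_primeFactors]
      refine ⟨⟨hpn, Int.natAbs_dvd_natAbs.2 hpb, by simpa using hb⟩, ?_⟩
      rwa [Int.natAbs_dvd]
    exact (Int.dvd_natAbs.2 dvd_rfl).trans (Finset.dvd_prod_of_mem (fun q : ℕ => (q : ℤ)) this)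

lemma not_dvd_N {N α p : ℤ} (hα : N ^ 2 ∣ α - 1) (hp : Prime p) (h : p ∣ α) : ¬ p ∣ N := by
  intro hd
  have h1 : p ∣ α - 1 := (hd.trans (dvd_pow_self N two_ne_zero)).trans hα
  have h2 : p ∣ 1 := by simpa using dvd_sub h h1
  exact hp.not_isUnit (isUnit_of_dvd_one h2)

lemma Moves.prim4 {N : ℤ} (hN : 4 ∣ N) (hN0 : N ≠ 0) {T : ℤ → ℤ → ℤ → ℤ → ℤ → Prop}
    (h : Moves N T) (α a c b β : ℤ) (hα : N ^ 2 ∣ α - 1) (hb0 : b ≠ 0)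
    (hprim : ∀ p : ℤ, Prime p → p ∣ α → p ∣ c → p ∣ b → p ∣ β → False)
    (hf : α * β + a * b + c ^ 2 = 0) (ha : N ∣ a) (hb : N ∣ b) (hc : N ∣ c) :
    T α a c b β := by
  obtain ⟨r, hr⟩ := exists_sep b α hb0
  apply h.ez (N * r) _ _ _ _ _ (Dvd.intro _ rfl)
  refine h.coprime hN hN0 _ _ _ _ _ ?_ hb0 ?_ ?_ ha hb ?_
  · obtain ⟨c1, rfl⟩ := hc
    obtain ⟨j, hj⟩ := hα
    exact ⟨j - 2 * r * c1 - r ^ 2 * β, by linear_combination hj⟩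
  · apply isCoprime_of_prime_dvd (fun h0 => hb0 h0.2)
    intro p hp h1 h2
    by_cases hpa : p ∣ α
    · have hpc : p ∣ c := by
        apply hp.dvd_of_dvd_pow (n := 2)
        have : c ^ 2 = -(α * β) - a * b := by linear_combination hf
        rw [this]
        exact dvd_sub ((dvd_neg).2 (hpa.mul_right _)) (h2.mul_left _)
      have h3 : p ∣ (N * r) ^ 2 * β := by
        have e : (N * r) ^ 2 * β = α - 2 * (N * r) * c - (α - 2 * (N * r) * c - (N * r) ^ 2 * β) := by
          ring
        rw [e]
        exact dvd_sub (dvd_sub hpa (hpc.mul_left _)) h1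
      rcases hp.dvd_or_dvd h3 with h4 | h4
      · rcases hp.dvd_or_dvd (hp.dvd_of_dvd_pow h4) with h5 | h5
        · exact not_dvd_N hα hp hpa h5
        · exact (hr p hp h2).1 h5 hpa
      · exact hprim p hp hpa hpc h2 h4
    · have hpr := (hr p hp h2).2 hpa
      apply hpa
      have e : α = (α - 2 * (N * r) * c - (N * r) ^ 2 * β) + r * (2 * N * c + N ^ 2 * r * β) := by
        ring
      rw [e]
      exact dvd_add h1 (hpr.mul_right _)
  · linear_combination hf
  · exact dvd_add hc (by simp [mul_assoc])

lemma Moves.prim5 {N : ℤ} (hN : 4 ∣ N) (hN0 : N ≠ 0) {T : ℤ → ℤ → ℤ → ℤ → ℤ → Prop}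
    (h : Moves N T) (α a c b β : ℤ) (hα : N ^ 2 ∣ α - 1) (hb0 : b ≠ 0)
    (hprim : ∀ p : ℤ, Prime p → p ∣ α → p ∣ a → p ∣ c → p ∣ b → p ∣ β → False)
    (hf : α * β + a * b + c ^ 2 = 0) (ha : N ∣ a) (hb : N ∣ b) (hc : N ∣ c) :
    T α a c b β := by
  obtain ⟨t, ht⟩ := exists_sep b α hb0
  obtain ⟨r, hr, hrb⟩ : ∃ r : ℤ, (∀ p : ℤ, Prime p → p ∣ b → (p ∣ r ↔ ¬ p ∣ α)) ∧
      b + N * r * β ≠ 0 := by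
    by_cases h0 : b + N * t * β = 0
    · refine ⟨-t, fun p hp hpb => by rw [dvd_neg]; exact ht p hp hpb, ?_⟩
      intro h1
      apply hb0
      linarith
    · exact ⟨t, ht, h0⟩
  apply h.eq (N * r) _ _ _ _ _ (Dvd.intro _ rfl)
  refine h.prim4 hN hN0 _ _ _ _ _ ?_ hrb ?_ ?_ ha ?_ hc
  · obtain ⟨a1, rfl⟩ := ha
    obtain ⟨j, hj⟩ := hα
    exact ⟨j - r * a1, by linear_combination hj⟩
  · intro p hp h1 h2 h3 h4
    have hpb : p ∣ b := by
      have : b = (b + N * r * β) - N * r * β := by ring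
      rw [this]; exact dvd_sub h3 (h4.mul_left _)
    by_cases hpa : p ∣ α
    · have h5 : p ∣ N * r * a := by
        have : N * r * a = α - (α - N * r * a) := by ring
        rw [this]; exact dvd_sub hpa h1
      rcases hp.dvd_or_dvd h5 with h6 | h6
      · rcases hp.dvd_or_dvd h6 with h7 | h7
        · exact not_dvd_N hα hp hpa h7
        · exact (hr p hp hpb).1 h7 hpa
      · exact hprim p hp hpa h6 h2 hpb h4
    · have hpr := (hr p hp hpb).2 hpa
      apply hpa
      have e : α = (α - N * r * a) + r * (N * a) := by ring
      rw [e]; exact dvd_add h1 (hpr.mul_right _)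
  · linear_combination hf
  · exact dvd_add hb (by simp [mul_assoc])

theorem Moves.main {N : ℤ} (hN : 4 ∣ N) (hN0 : N ≠ 0) {T : ℤ → ℤ → ℤ → ℤ → ℤ → Prop}
    (h : Moves N T) (α a c b β : ℤ) (hα : N ^ 2 ∣ α - 1)
    (hprim : ∀ p : ℤ, Prime p → p ∣ α → p ∣ a → p ∣ c → p ∣ b → p ∣ β → False)
    (hf : α * β + a * b + c ^ 2 = 0) (ha : N ∣ a) (hb : N ∣ b) (hc : N ∣ c) :
    T α a c b β := by
  by_cases hb0 : b = 0
  · subst hb0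
    have hα0 : α ≠ 0 := by
      rintro rfl
      have h1 : (4 : ℤ) ∣ 0 - 1 := (hN.trans (dvd_pow_self N two_ne_zero)).trans hα
      norm_num at h1
    apply h.fq N _ _ _ _ _ dvd_rfl
    refine h.prim5 hN hN0 _ _ _ _ _ hα (by simp [hN0, hα0]) ?_ ?_ ha (by simp) hc
    · intro p hp h1 h2 h3 h4 h5
      refine hprim p hp h1 h2 h3 (dvd_zero _) ?_
      have : β = (β - N * a) + N * a := by ring
      rw [this]; exact dvd_add h5 (h2.mul_left _)
    · linear_combination hf
  · exact h.prim5 hN hN0 _ _ _ _ _ hα hb0 hprim hf ha hb hc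

/-- The matrix `M` is (the matrix of) an element of `H`. -/
def InH (H : Subgroup (GL (Fin 5) ℤ)) (M : Matrix (Fin 5) (Fin 5) ℤ) : Prop :=
  ∃ g ∈ H, (g : Matrix (Fin 5) (Fin 5) ℤ) = M

lemma InH.mul' {H : Subgroup (GL (Fin 5) ℤ)} {M M' M'' : Matrix (Fin 5) (Fin 5) ℤ}
    (h : InH H M) (h' : InH H M') (e : M * M' = M'') : InH H M'' := by
  obtain ⟨g, hg, rfl⟩ := h
  obtain ⟨g', hg', rfl⟩ := h'
  exact ⟨g * g', H.mul_mem hg hg', e⟩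

lemma InH.inv' {H : Subgroup (GL (Fin 5) ℤ)} {M M' : Matrix (Fin 5) (Fin 5) ℤ}
    (h : InH H M) (e : M' * M = 1) : InH H M' := by
  obtain ⟨g, hg, rfl⟩ := h
  refine ⟨g⁻¹, H.inv_mem hg, ?_⟩
  calc ((g⁻¹ : GL (Fin 5) ℤ) : Matrix (Fin 5) (Fin 5) ℤ)
      = (M' * (g : Matrix (Fin 5) (Fin 5) ℤ)) * ((g⁻¹ : GL (Fin 5) ℤ) : Matrix (Fin 5) (Fin 5) ℤ) := by
        rw [e, one_mul]
    _ = M' := by rw [mul_assoc, Units.mul_inv, mul_one]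

/-- An explicit element of the group. -/
def matR : Matrix (Fin 5) (Fin 5) ℤ :=
  !![-8, -13, -4, 3, -5; 1, 7, 7, 0, -11; 2, -4, -7, 0, 18; 0, 5, 6, 0, -12; 6, 6, -1, -2, 11]

/-- An explicit element of the group. -/
def matS : Matrix (Fin 5) (Fin 5) ℤ :=
  !![1, -1, -1, 0, 1; 0, 6, 5, 0, -5; 0, -9, -8, 0, 9; 0, 7, 7, 1, -7; 0, -2, -2, 0, 3]

/-- An explicit element of the group. -/
def matSa : Matrix (Fin 5) (Fin 5) ℤ :=
  !![5, 1, -1, -1, 0; -12, 0, 6, 5, 0; 16, 0, -9, -8, 0; -11, 0, 7, 7, 1; 3, 0, -2, -2, 0]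

/-- An explicit element of the group. -/
def matU1 : Matrix (Fin 5) (Fin 5) ℤ :=
  !![4, 9, 15, 21, 27; -15, -32, -51, -69, -87; 24, 48, 73, 96, 120; -21, -39, -57, -74, -93; 9, 15, 21, 27, 34]

/-- An explicit element of the group. -/
def matU2 : Matrix (Fin 5) (Fin 5) ℤ :=
  !![34, 87, -99, -189, 57; -231, -392, 165, 435, -303; 324, 540, -203, -564, 420; -237, -399, 159, 430, -309; 111, 165, -21, -111, 136]

/-- An explicit element of the group. -/
def matU3 : Matrix (Fin 5) (Fin 5) ℤ :=
  !![-278, 111, 165, -21, -111; 759, -410, -573, -15, 255; -1014, 546, 763, 18, -342; 717, -453, -615, -56, 213; -183, 207, 261, 75, -14]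

/-- An explicit element of the group. -/
def matV1 : Matrix (Fin 5) (Fin 5) ℤ :=
  !![175, -522, 30, 54, 78; 129, -380, 21, 39, 57; 342, -1002, 55, 102, 150; 135, -423, 27, 46, 63; 252, -720, 36, 72, 109]

/-- An explicit element of the group. -/
def matV2 : Matrix (Fin 5) (Fin 5) ℤ :=
  !![-83, -1020, 348, 564, -180; -87, -596, 237, 399, -159; -246, -1494, 619, 1050, -438; -81, -639, 243, 406, -153; -198, -1026, 450, 774, -341]

/-- An explicit element of the group. -/
def matV3 : Matrix (Fin 5) (Fin 5) ℤ :=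
  !![1549, -2076, -900, 660, 876; 1119, -1262, -717, 453, 615; 3000, -3480, -1895, 1224, 1656; 1161, -1557, -675, 496, 657; 2124, -1728, -1548, 792, 1117]

/-- The adapted basis. -/
def matP : Matrix (Fin 5) (Fin 5) ℤ :=
  !![1, 1, 0, -1, 4; -3, 0, 0, 0, 3; 4, 0, 2, 3, 8; -3, 0, 0, -6, 3; 1, -1, -2, 4, 6]

/-- `24` times the inverse of `matP`. -/
def matP' : Matrix (Fin 5) (Fin 5) ℤ :=
  !![1, -7, 1, 1, 1; 19, 7, -5, -9, -5; -6, 4, 6, 0, -6; 0, 4, 0, -4, 0; 1, 1, 1, 1, 1]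

lemma explicit_mem {H : Subgroup (GL (Fin 5) ℤ)} (hA : InH H matA) (hB : InH H matB) :
    InH H matR ∧ InH H matS ∧ InH H matSa ∧ InH H matU1 ∧ InH H matU2 ∧ InH H matU3 ∧ InH H matV1 ∧ InH H matV2 ∧ InH H matV3 := by
  have ha : InH H !![4, 1, 0, 0, 0; -7, 0, 1, 0, 0; 7, 0, 0, 1, 0; -4, 0, 0, 0, 1; 1, 0, 0, 0, 0] := hA.inv' (by decide +kernel)
  have hb : InH H !![-1, 1, 0, 0, 0; -2, 0, 1, 0, 0; -2, 0, 0, 1, 0; -1, 0, 0, 0, 1; -1, 0, 0, 0, 0] := hB.inv' (by decide +kernel)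
  have hB2 : InH H !![0, 0, 0, -1, 1; 0, 0, 0, -1, 0; 1, 0, 0, -2, 1; 0, 1, 0, -2, 0; 0, 0, 1, -1, -1] := hB.mul' hB (by decide +kernel)
  have hB4 : InH H !![0, -1, 1, 1, -1; 0, -1, 0, 2, 0; 0, -2, 1, 2, 0; 0, -2, 0, 3, 0; 1, -1, -1, 1, 2] := hB2.mul' hB2 (by decide +kernel)
  have hb4 : InH H !![2, 1, -1, -1, 1; 0, 3, 0, -2, 0; 0, 2, 1, -2, 0; 0, 2, 0, -1, 0; -1, 1, 1, -1, 0] := hB4.inv' (by decide +kernel)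
  have hb2 : InH H !![-1, -1, 1, 0, 0; 0, -2, 0, 1, 0; 1, -2, 0, 0, 1; 0, -1, 0, 0, 0; 1, -1, 0, 0, 0] := hB2.inv' (by decide +kernel)
  have hA2 : InH H !![0, 0, 0, 1, 4; 0, 0, 0, -4, -15; 1, 0, 0, 7, 24; 0, 1, 0, -7, -21; 0, 0, 1, 4, 9] := hA.mul' hA (by decide +kernel)
  have hA3 : InH H !![0, 0, 1, 4, 9; 0, 0, -4, -15, -32; 0, 0, 7, 24, 48; 1, 0, -7, -21, -39; 0, 1, 4, 9, 15] := hA.mul' hA2 (by decide +kernel)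
  have hA6 : InH H !![4, 9, 15, 21, 27; -15, -32, -51, -69, -87; 24, 48, 73, 96, 120; -21, -39, -57, -74, -93; 9, 15, 21, 27, 34] := hA3.mul' hA3 (by decide +kernel)
  have hR_0 : InH H !![-1, 2, 1, -1, -1; -13, 0, 3, 0, -2; 1, 0, 2, 1, -2; -10, 0, 2, 0, -1; 0, -1, 1, 1, -1] := hb4.mul' ha (by decide +kernel)
  have hR_1 : InH H !![-1, 4, 1, -3, -1; -24, -9, 14, 9, -13; 4, 5, -1, -4, 1; -19, -7, 11, 7, -10; 1, 0, 0, 0, 0] := hR_0.mul' hb4 (by decide +kernel)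
  have hR_2 : InH H !![-14, -1, 4, 1, -3; 16, -24, -9, 14, 9; -9, 4, 5, -1, -4; 12, -19, -7, 11, 7; 4, 1, 0, 0, 0] := hR_1.mul' ha (by decide +kernel)
  have hR_3 : InH H !![4, 1, -3, 8, -7; -9, 14, 9, -11, -2; 5, -1, -4, 1, 0; -7, 11, 7, -8, -2; 0, 0, 0, -5, 4] := hR_2.mul' hB2 (by decide +kernel)
  have hR_4 : InH H !![1, -3, 8, -7, -105; 14, 9, -11, -2, 67; -1, -4, 1, 0, -26; 11, 7, -8, -2, 46; 0, 0, -5, 4, 51] := hR_3.mul' hA (by decide +kernel)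
  have hR_5 : InH H !![-105, 105, 114, -115, -211; 67, -64, -64, 71, 120; -26, 29, 26, -33, -51; 46, -44, -43, 49, 81; 51, -49, -56, 53, 102] := hR_4.mul' hB4 (by decide +kernel)
  have hR_6 : InH H !![105, 114, -115, -211, 234; -64, -64, 71, 120, -142; 29, 26, -33, -51, 67; -44, -43, 49, 81, -98; -49, -56, 53, 102, -108] := hR_5.mul' hA (by decide +kernel)
  have hR_7 : InH H !![-126, 105, 114, -115, -211; 72, -64, -64, 71, 120; -31, 29, 26, -33, -51; 49, -44, -43, 49, 81; 61, -49, -56, 53, 102] := hR_6.mul' hb (by decide +kernel)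
  have hR_8 : InH H !![-192, -126, 105, 114, -115; 124, 72, -64, -64, 71; -64, -31, 29, 26, -33; 88, 49, -44, -43, 49; 85, 61, -49, -56, 53] := hR_7.mul' ha (by decide +kernel)
  have hR_9 : InH H !![-115, -5, 28, -7, -38; 71, -11, -11, 19, 18; -33, 18, -2, -23, -2; 49, -12, -5, 18, 10; 53, 11, -17, -6, 21] := hR_8.mul' hB4 (by decide +kernel)
  have hR_10 : InH H !![-5, 28, -7, -38, -2; -11, -11, 19, 18, -23; 18, -2, -23, -2, 34; -12, -5, 18, 10, -24; 11, -17, -6, 21, 16] := hR_9.mul' hA (by decide +kernel)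
  have hR : InH H !![-8, -13, -4, 3, -5; 1, 7, 7, 0, -11; 2, -4, -7, 0, 18; 0, 5, 6, 0, -12; 6, 6, -1, -2, 11] := hR_10.mul' hb4 (by decide +kernel)
  have hRi : InH H !![-10, -17, 14, 27, -15; 24, 36, -30, -55, 36; -32, -46, 39, 70, -48; 25, 36, -29, -53, 37; -6, -8, 7, 12, -9] := hR.inv' (by decide +kernel)
  have hx1 : InH H !![-41, -40, -25, -12, -14; -32, -44, -62, -87, -116; 62, 80, 101, 132, 174; -39, -52, -69, -93, -123; 51, 57, 56, 61, 80] := hR.mul' hA6 (by decide +kernel)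
  have hu2 : InH H !![34, 87, -99, -189, 57; -231, -392, 165, 435, -303; 324, 540, -203, -564, 420; -237, -399, 159, 430, -309; 111, 165, -21, -111, 136] := hx1.mul' hRi (by decide +kernel)
  have hx2 : InH H !![111, 165, -21, -111, 136; -410, -573, -15, 255, -487; 546, 763, 18, -342, 649; -453, -615, -56, 213, -532; 207, 261, 75, -14, 235] := hA.mul' hu2 (by decide +kernel)
  have hu3 : InH H !![-278, 111, 165, -21, -111; 759, -410, -573, -15, 255; -1014, 546, 763, 18, -342; 717, -453, -615, -56, 213; -183, 207, 261, 75, -14] := hx2.mul' ha (by decide +kernel)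
  have ha2 : InH H !![9, 4, 1, 0, 0; -21, -7, 0, 1, 0; 24, 7, 0, 0, 1; -15, -4, 0, 0, 0; 4, 1, 0, 0, 0] := ha.mul' ha (by decide +kernel)
  have hw_0 : InH H !![-8, -19, 9, 4, 1; 21, 34, -21, -7, 0; -23, -39, 24, 7, 0; 15, 23, -15, -4, 0; -4, -6, 4, 1, 0] := ha2.mul' hb2 (by decide +kernel)
  have hw_1 : InH H !![23, -8, -19, 9, 4; -40, 21, 34, -21, -7; 46, -23, -39, 24, 7; -27, 15, 23, -15, -4; 7, -4, -6, 4, 1] := hw_0.mul' hb (by decide +kernel)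
  have hw_2 : InH H !![-8, -19, 9, 4, -125; 21, 34, -21, -7, 233; -23, -39, 24, 7, -275; 15, 23, -15, -4, 163; -4, -6, 4, 1, -43] := hw_1.mul' hA (by decide +kernel)
  have hw_3 : InH H !![-125, 126, 126, -141, -242; 233, -232, -233, 259, 445; -275, 275, 276, -307, -527; 163, -163, -163, 182, 311; -43, 43, 43, -48, -82] := hw_2.mul' hB4 (by decide +kernel)
  have hw : InH H !![126, 126, -141, -242, 272; -232, -233, 259, 445, -503; 275, 276, -307, -527, 598; -163, -163, 182, 311, -356; 43, 43, -48, -82, 94] := hw_3.mul' hA (by decide +kernel)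
  have hwi : InH H !![9, -4, -5, 91, 329; -5, -2, -1, -37, -130; 7, 0, 0, 74, 260; -2, -2, -2, -15, -49; 0, 1, 1, 0, -1] := hw.inv' (by decide +kernel)
  have hS_0 : InH H !![-125, 126, 126, -141, -242; 233, -232, -233, 259, 445; -275, 275, 276, -307, -527; 163, -163, -163, 182, 311; -43, 43, 43, -48, -82] := hw.mul' ha (by decide +kernel)
  have hS_1 : InH H !![126, 126, -141, -242, 271; -232, -233, 259, 445, -498; 275, 276, -307, -527, 589; -163, -163, 182, 311, -349; 43, 43, -48, -82, 92] := hS_0.mul' hB (by decide +kernel)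
  have hS : InH H !![1, -1, -1, 0, 1; 0, 6, 5, 0, -5; 0, -9, -8, 0, 9; 0, 7, 7, 1, -7; 0, -2, -2, 0, 3] := hS_1.mul' hwi (by decide +kernel)
  have hSa : InH H !![5, 1, -1, -1, 0; -12, 0, 6, 5, 0; 16, 0, -9, -8, 0; -11, 0, 7, 7, 1; 3, 0, -2, -2, 0] := hS.mul' ha (by decide +kernel)
  have hy1 : InH H !![30, 54, 78, 101, 127; 21, 39, 57, 74, 93; 55, 102, 150, 196, 247; 27, 46, 63, 79, 99; 36, 72, 109, 143, 179] := hB2.mul' hA6 (by decide +kernel)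
  have hv1 : InH H !![175, -522, 30, 54, 78; 129, -380, 21, 39, 57; 342, -1002, 55, 102, 150; 135, -423, 27, 46, 63; 252, -720, 36, 72, 109] := hy1.mul' hb2 (by decide +kernel)
  have hy2 : InH H !![348, 564, -180, -541, 445; 237, 399, -159, -430, 309; 619, 1050, -438, -1160, 811; 243, 406, -153, -425, 315; 450, 774, -341, -883, 593] := hB2.mul' hu2 (by decide +kernel)
  have hv2 : InH H !![-83, -1020, 348, 564, -180; -87, -596, 237, 399, -159; -246, -1494, 619, 1050, -438; -81, -639, 243, 406, -153; -198, -1026, 450, 774, -341] := hy2.mul' hb2 (by decide +kernel)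
  have hy3 : InH H !![-900, 660, 876, 131, -227; -717, 453, 615, 56, -213; -1895, 1224, 1656, 166, -551; -675, 496, 657, 97, -171; -1548, 792, 1117, -1, -541] := hB2.mul' hu3 (by decide +kernel)
  have hv3 : InH H !![1549, -2076, -900, 660, 876; 1119, -1262, -717, 453, 615; 3000, -3480, -1895, 1224, 1656; 1161, -1557, -675, 496, 657; 2124, -1728, -1548, 792, 1117] := hy3.mul' hb2 (by decide +kernel)
  exact ⟨hR, hS, hSa, hA6, hu2, hu3, hv1, hv2, hv3⟩

/-- Unipotent matrices (in adapted coordinates) fixing the first basis vector. -/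
def matE (y : ℤ × ℤ × ℤ) : Matrix (Fin 5) (Fin 5) ℤ :=
  !![1, -y.2.2, -2 * y.2.1, -y.1, -(y.1 * y.2.2 + y.2.1 ^ 2); 0, 1, 0, 0, y.1; 0, 0, 1, 0, y.2.1;
    0, 0, 0, 1, y.2.2; 0, 0, 0, 0, 1]

/-- Unipotent matrices (in adapted coordinates) fixing the last basis vector. -/
def matF (y : ℤ × ℤ × ℤ) : Matrix (Fin 5) (Fin 5) ℤ :=
  !![1, 0, 0, 0, 0; y.1, 1, 0, 0, 0; y.2.1, 0, 1, 0, 0; y.2.2, 0, 0, 1, 0;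
    -(y.1 * y.2.2 + y.2.1 ^ 2), -y.2.2, -2 * y.2.1, -y.1, 1]

lemma matE_add (y y' : ℤ × ℤ × ℤ) : matE y * matE y' = matE (y + y') := by
  ext i j
  fin_cases i <;> fin_cases j <;>
    simp [matE, Matrix.mul_apply, Fin.sum_univ_succ] <;> ring

lemma matF_add (y y' : ℤ × ℤ × ℤ) : matF y * matF y' = matF (y + y') := by
  ext i j
  fin_cases i <;> fin_cases j <;>
    simp [matF, Matrix.mul_apply, Fin.sum_univ_succ] <;> ring

lemma matE_zero : matE 0 = 1 := by
  ext i j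
  fin_cases i <;> fin_cases j <;> simp [matE]

lemma matF_zero : matF 0 = 1 := by
  ext i j
  fin_cases i <;> fin_cases j <;> simp [matF]

/-- The parameters `y` for which a one-parameter-type family, conjugated by `matP`, lies in `H`. -/
def params (H : Subgroup (GL (Fin 5) ℤ)) (E : ℤ × ℤ × ℤ → Matrix (Fin 5) (Fin 5) ℤ)
    (hadd : ∀ y y', E y * E y' = E (y + y')) (h0 : E 0 = 1) : AddSubgroup (ℤ × ℤ × ℤ) where
  carrier := {y | ∃ g ∈ H, (g : Matrix (Fin 5) (Fin 5) ℤ) * matP = matP * E y}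
  zero_mem' := ⟨1, H.one_mem, by simp [h0]⟩
  add_mem' := by
    rintro y y' ⟨g, hg, h⟩ ⟨g', hg', h'⟩
    refine ⟨g * g', H.mul_mem hg hg', ?_⟩
    rw [Units.val_mul, mul_assoc, h', ← mul_assoc, h, mul_assoc, hadd]
  neg_mem' := by
    rintro y ⟨g, hg, h⟩
    refine ⟨g⁻¹, H.inv_mem hg, ?_⟩
    calc ((g⁻¹ : GL (Fin 5) ℤ) : Matrix (Fin 5) (Fin 5) ℤ) * matP
        = ((g⁻¹ : GL (Fin 5) ℤ) : Matrix (Fin 5) (Fin 5) ℤ) * (matP * E y) * E (-y) := by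
          rw [mul_assoc, mul_assoc, hadd, add_neg_cancel, h0, mul_one]
      _ = matP * E (-y) := by rw [← h, ← mul_assoc, Units.inv_mul, one_mul]

lemma memE {H : Subgroup (GL (Fin 5) ℤ)} (hA : InH H matA) (hB : InH H matB) (a c b : ℤ)
    (ha : 5616 ∣ a) (hc : 5616 ∣ c) (hb : 5616 ∣ b) :
    ∃ g ∈ H, (g : Matrix (Fin 5) (Fin 5) ℤ) * matP = matP * matE (a, c, b) := by
  obtain ⟨-, -, -, ⟨g1, hg1, e1⟩, ⟨g2, hg2, e2⟩, ⟨g3, hg3, e3⟩, -⟩ := explicit_mem hA hB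
  have m1 : ((-24, 12, 24) : ℤ × ℤ × ℤ) ∈ params H matE matE_add matE_zero :=
    ⟨g1, hg1, by rw [e1]; decide +kernel⟩
  have m2 : ((-1032, 156, 24) : ℤ × ℤ × ℤ) ∈ params H matE matE_add matE_zero :=
    ⟨g2, hg2, by rw [e2]; decide +kernel⟩
  have m3 : ((-456, -276, 168) : ℤ × ℤ × ℤ) ∈ params H matE matE_add matE_zero :=
    ⟨g3, hg3, by rw [e3]; decide +kernel⟩
  obtain ⟨a, rfl⟩ := ha
  obtain ⟨c, rfl⟩ := hc
  obtain ⟨b, rfl⟩ := hb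
  have := add_mem (add_mem (AddSubgroup.zsmul_mem _ m1 (19 * a + 94 * c + 206 * b))
    (AddSubgroup.zsmul_mem _ m2 (-5 * a + 4 * c - 7 * b)))
    (AddSubgroup.zsmul_mem _ m3 (-2 * a - 14 * c + 5 * b))
  have e : (19 * a + 94 * c + 206 * b) • ((-24, 12, 24) : ℤ × ℤ × ℤ)
    + (-5 * a + 4 * c - 7 * b) • ((-1032, 156, 24) : ℤ × ℤ × ℤ)
    + (-2 * a - 14 * c + 5 * b) • ((-456, -276, 168) : ℤ × ℤ × ℤ)
    = (5616 * a, 5616 * c, 5616 * b) := by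
    ext <;> simp <;> ring
  rw [e] at this
  exact this

lemma memF {H : Subgroup (GL (Fin 5) ℤ)} (hA : InH H matA) (hB : InH H matB) (a c b : ℤ)
    (ha : 5616 ∣ a) (hc : 5616 ∣ c) (hb : 5616 ∣ b) :
    ∃ g ∈ H, (g : Matrix (Fin 5) (Fin 5) ℤ) * matP = matP * matF (a, c, b) := by
  obtain ⟨-, -, -, -, -, -, ⟨g1, hg1, e1⟩, ⟨g2, hg2, e2⟩, ⟨g3, hg3, e3⟩⟩ := explicit_mem hA hB
  have m1 : ((24, 12, -24) : ℤ × ℤ × ℤ) ∈ params H matF matF_add matF_zero :=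
    ⟨g1, hg1, by rw [e1]; decide +kernel⟩
  have m2 : ((744, -132, -24) : ℤ × ℤ × ℤ) ∈ params H matF matF_add matF_zero :=
    ⟨g2, hg2, by rw [e2]; decide +kernel⟩
  have m3 : ((1176, 444, -168) : ℤ × ℤ × ℤ) ∈ params H matF matF_add matF_zero :=
    ⟨g3, hg3, by rw [e3]; decide +kernel⟩
  obtain ⟨a, rfl⟩ := ha
  obtain ⟨c, rfl⟩ := hc
  obtain ⟨b, rfl⟩ := hb
  have := add_mem (add_mem (AddSubgroup.zsmul_mem _ m1 (-19 * a - 56 * c - 281 * b))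
    (AddSubgroup.zsmul_mem _ m2 (5 * a - 14 * c - 2 * b)))
    (AddSubgroup.zsmul_mem _ m3 (2 * a + 10 * c + 7 * b))
  have e : (-19 * a - 56 * c - 281 * b) • ((24, 12, -24) : ℤ × ℤ × ℤ)
    + (5 * a - 14 * c - 2 * b) • ((744, -132, -24) : ℤ × ℤ × ℤ)
    + (2 * a + 10 * c + 7 * b) • ((1176, 444, -168) : ℤ × ℤ × ℤ)
    = (5616 * a, 5616 * c, 5616 * b) := by
    ext <;> simp <;> ring
  rw [e] at this
  exact this

/-- The isotropic vector. -/
def evec : Fin 5 → ℤ := ![1, -3, 4, -3, 1]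

/-- The vector with given adapted coordinates can be moved to `evec` by `H`. -/
def Reach (H : Subgroup (GL (Fin 5) ℤ)) (α a c b β : ℤ) : Prop :=
  ∃ h ∈ H, (h : Matrix (Fin 5) (Fin 5) ℤ) *ᵥ (matP *ᵥ ![α, a, c, b, β]) = evec

lemma Reach.step {H : Subgroup (GL (Fin 5) ℤ)} {M : Matrix (Fin 5) (Fin 5) ℤ}
    (hM : ∃ g ∈ H, (g : Matrix (Fin 5) (Fin 5) ℤ) * matP = matP * M)
    {α a c b β α' a' c' b' β' : ℤ} (hv : M *ᵥ ![α, a, c, b, β] = ![α', a', c', b', β'])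
    (h : Reach H α' a' c' b' β') : Reach H α a c b β := by
  obtain ⟨g, hg, e⟩ := hM
  obtain ⟨k, hk, e'⟩ := h
  refine ⟨k * g, H.mul_mem hk hg, ?_⟩
  rw [Units.val_mul, ← Matrix.mulVec_mulVec, Matrix.mulVec_mulVec (M := (g : Matrix (Fin 5) (Fin 5) ℤ)),
    e, ← Matrix.mulVec_mulVec, hv, e']

lemma matE_mulVec (x y z α a c b β : ℤ) : matE (x, y, z) *ᵥ ![α, a, c, b, β] =
    ![α - (x * b + z * a + 2 * y * c) - (x * z + y ^ 2) * β, a + x * β, c + y * β, b + z * β, β] := by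
  ext i
  fin_cases i <;> simp [matE, Matrix.mulVec, dotProduct, Fin.sum_univ_succ] <;> ring

lemma matF_mulVec (x y z α a c b β : ℤ) : matF (x, y, z) *ᵥ ![α, a, c, b, β] =
    ![α, a + x * α, c + y * α, b + z * α,
      β - (x * b + z * a + 2 * y * c) - (x * z + y ^ 2) * α] := by
  ext i
  fin_cases i <;> simp [matF, Matrix.mulVec, dotProduct, Fin.sum_univ_succ] <;> ring

lemma moves_reach {H : Subgroup (GL (Fin 5) ℤ)} (hA : InH H matA) (hB : InH H matB) :
    Moves 5616 (Reach H) where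
  base := ⟨1, H.one_mem, by decide +kernel⟩
  ep s α a c b β hs h := by
    refine Reach.step (memE hA hB s 0 0 hs (by simp) (by simp)) (matE_mulVec _ _ _ _ _ _ _ _) ?_
    convert h using 1 <;> ring
  eq s α a c b β hs h := by
    refine Reach.step (memE hA hB 0 0 s (by simp) (by simp) hs) (matE_mulVec _ _ _ _ _ _ _ _) ?_
    convert h using 1 <;> ring
  ez s α a c b β hs h := by
    refine Reach.step (memE hA hB 0 s 0 (by simp) hs (by simp)) (matE_mulVec _ _ _ _ _ _ _ _) ?_
    convert h using 1 <;> ring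
  fp s α a c b β hs h := by
    refine Reach.step (memF hA hB s 0 0 hs (by simp) (by simp)) (matF_mulVec _ _ _ _ _ _ _ _) ?_
    convert h using 1 <;> ring
  fq s α a c b β hs h := by
    refine Reach.step (memF hA hB 0 0 s (by simp) (by simp) hs) (matF_mulVec _ _ _ _ _ _ _ _) ?_
    convert h using 1 <;> ring
  fz s α a c b β hs h := by
    refine Reach.step (memF hA hB 0 s 0 (by simp) hs (by simp)) (matF_mulVec _ _ _ _ _ _ _ _) ?_
    convert h using 1 <;> ring

/-- The symmetric bilinear form. -/
def bq (u v : Fin 5 → ℤ) : ℤ := u ⬝ᵥ (matQ *ᵥ v)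

lemma bq_inv {g : GL (Fin 5) ℤ} (hg : g ∈ orthogonalSubgroup matQ) (u v : Fin 5 → ℤ) :
    bq ((g : Matrix (Fin 5) (Fin 5) ℤ) *ᵥ u) ((g : Matrix (Fin 5) (Fin 5) ℤ) *ᵥ v) = bq u v := by
  have hg' : (g : Matrix (Fin 5) (Fin 5) ℤ)ᵀ * matQ * (g : Matrix (Fin 5) (Fin 5) ℤ) = matQ := hg
  unfold bq
  conv_rhs => rw [← hg']
  rw [← Matrix.mulVec_mulVec, ← Matrix.mulVec_mulVec, Matrix.dotProduct_mulVec u,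
    Matrix.vecMul_transpose]

lemma bq_matP (α a c b β : ℤ) : bq (matP *ᵥ ![α, a, c, b, β]) (matP *ᵥ ![α, a, c, b, β])
    = 576 * (α * β + a * b + c ^ 2) := by
  simp [bq, matP, matQ, Matrix.mulVec, dotProduct, Fin.sum_univ_succ]
  ring

/-- The congruence modulus. -/
def KK : ℕ := 24 * 5616 ^ 2

lemma matP_mul : matP * matP' = (24 : ℤ) • (1 : Matrix (Fin 5) (Fin 5) ℤ) := by decide +kernel

/-- Elements congruent to the identity can be moved into the stabilizer of `evec`. -/
lemma congr_reach {H : Subgroup (GL (Fin 5) ℤ)} (hA : InH H matA) (hB : InH H matB)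
    {g : GL (Fin 5) ℤ} (hg : g ∈ orthogonalSubgroup matQ) (D : Matrix (Fin 5) (Fin 5) ℤ)
    (hD : (g : Matrix (Fin 5) (Fin 5) ℤ) = 1 + (KK : ℤ) • D) :
    ∃ h ∈ H, ((h * g : GL (Fin 5) ℤ) : Matrix (Fin 5) (Fin 5) ℤ) *ᵥ evec = evec := by
  set w := matP' *ᵥ (D *ᵥ evec) with hw
  have hPv : matP *ᵥ ![1 + 5616 ^ 2 * w 0, 5616 ^ 2 * w 1, 5616 ^ 2 * w 2, 5616 ^ 2 * w 3,
      5616 ^ 2 * w 4] = (g : Matrix (Fin 5) (Fin 5) ℤ) *ᵥ evec := by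
    have e1 : ![1 + 5616 ^ 2 * w 0, 5616 ^ 2 * w 1, 5616 ^ 2 * w 2, 5616 ^ 2 * w 3,
      5616 ^ 2 * w 4] = ![1, 0, 0, 0, 0] + (5616 ^ 2 : ℤ) • w := by
      ext i; fin_cases i <;> simp
    have e2 : matP *ᵥ ![1, 0, 0, 0, 0] = evec := by decide +kernel
    rw [e1, Matrix.mulVec_add, e2, Matrix.mulVec_smul, hw, Matrix.mulVec_mulVec, matP_mul, hD,
      Matrix.add_mulVec, Matrix.one_mulVec, Matrix.smul_mulVec, Matrix.smul_mulVec,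
      Matrix.one_mulVec, smul_smul]
    norm_num [KK]
  have hr : Reach H (1 + 5616 ^ 2 * w 0) (5616 ^ 2 * w 1) (5616 ^ 2 * w 2) (5616 ^ 2 * w 3)
      (5616 ^ 2 * w 4) := by
    refine (moves_reach hA hB).main (by norm_num) (by norm_num) _ _ _ _ _ ?_ ?_ ?_ ?_ ?_ ?_
    · exact ⟨w 0, by ring⟩
    · intro p hp h1 h2 h3 h4 h5
      obtain ⟨k1, e1⟩ := h1
      obtain ⟨k2, e2⟩ := h2
      obtain ⟨k3, e3⟩ := h3
      obtain ⟨k4, e4⟩ := h4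
      obtain ⟨k5, e5⟩ := h5
      rw [e1, e2, e3, e4, e5] at hPv
      have e6 : ![p * k1, p * k2, p * k3, p * k4, p * k5] = p • ![k1, k2, k3, k4, k5] := by
        ext i; fin_cases i <;> simp
      rw [e6, Matrix.mulVec_smul] at hPv
      have e7 : p • (((g⁻¹ : GL (Fin 5) ℤ) : Matrix (Fin 5) (Fin 5) ℤ) *ᵥ
          (matP *ᵥ ![k1, k2, k3, k4, k5])) = evec := by
        rw [← Matrix.mulVec_smul, hPv, Matrix.mulVec_mulVec, Units.inv_mul, Matrix.one_mulVec]
      have e8 := congrFun e7 0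
      simp only [Pi.smul_apply, smul_eq_mul, evec, Matrix.cons_val_zero] at e8
      exact hp.not_isUnit (isUnit_of_dvd_one ⟨_, e8.symm⟩)
    · have := bq_inv hg evec evec
      rw [← hPv, bq_matP] at this
      have h0 : bq evec evec = 0 := by decide +kernel
      rw [h0] at this
      linarith
    · exact ⟨5616 * w 1, by ring⟩
    · exact ⟨5616 * w 3, by ring⟩
    · exact ⟨5616 * w 2, by ring⟩
  obtain ⟨h, hh, e⟩ := hr
  refine ⟨h, hh, ?_⟩
  rw [Units.val_mul, ← Matrix.mulVec_mulVec, ← hPv, e]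

lemma descent_aux (p k r : ℤ) (hq : p ^ 2 + 14 * p * r + r ^ 2 + 24 * k * (p + r) = 9)
    (hM : 0 < p + 2 * k + r) : 0 < p + 2 * k + 3 * r := by
  by_contra hcon
  have h1 : 0 ≤ (p + 2 * k + r) * -(p + 2 * k + 3 * r) := mul_nonneg hM.le (by linarith)
  nlinarith [sq_nonneg (11 * p - 6 * (p + 2 * k) - r), sq_nonneg r]

lemma descent_end (p k r : ℤ) (hq : p ^ 2 + 14 * p * r + r ^ 2 + 24 * k * (p + r) = 9)
    (hp : 0 ≤ p) (hk : 0 ≤ k) (hr : 0 ≤ r) :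
    (p = 3 ∧ k = 0 ∧ r = 0) ∨ (p = 0 ∧ k = 0 ∧ r = 3) := by
  have hpr : 0 ≤ p * r := mul_nonneg hp hr
  have hkp : 0 ≤ k * p := mul_nonneg hk hp
  have hkr : 0 ≤ k * r := mul_nonneg hk hr
  have hp3 : p ≤ 3 := by nlinarith
  have hr3 : r ≤ 3 := by nlinarith
  interval_cases p <;> interval_cases r <;> omega

/-- Invariants for the triangle group descent. -/
lemma descent (Tp : ℤ → ℤ → ℤ → Prop) (h1 : Tp 1 (-1) 1) (h2 : Tp 4 (-1) 4)
    (hS : ∀ x y z, Tp z y x → Tp x y z)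
    (hT : ∀ x y z, Tp x (y - (2 * x + y - z)) (z + (2 * x + y - z)) → Tp x y z)
    (hR : ∀ x y z, Tp (x + 4 * (x - 4 * y - 2 * z)) (y - (x - 4 * y - 2 * z))
      (z + 5 * (x - 4 * y - 2 * z)) → Tp x y z) :
    ∀ n : ℕ, ∀ x y z : ℤ, x - 3 * y - z = n → 0 < x - 3 * y - z →
      13 * (x ^ 2 + y ^ 2 + z ^ 2) + 10 * x * y - 22 * x * z + 10 * y * z = -3 → Tp x y z := by
  intro n
  induction n using Nat.strong_induction_on with
  | _ n ih =>
    intro x y z hn hpos hq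
    obtain ⟨p, hp⟩ : ∃ p, p = x - 4 * y - 2 * z := ⟨_, rfl⟩
    obtain ⟨k, hk⟩ : ∃ k, k = z - x := ⟨_, rfl⟩
    obtain ⟨r, hr⟩ : ∃ r, r = 2 * x + y - z := ⟨_, rfl⟩
    have hM : x - 3 * y - z = p + 2 * k + r := by rw [hp, hk, hr]; ring
    have hq' : p ^ 2 + 14 * p * r + r ^ 2 + 24 * k * (p + r) = 9 := by
      rw [hp, hk, hr]; linear_combination -3 * hq
    by_cases hk0 : k < 0
    · apply hS
      have hlt : 0 < z - 3 * y - x := by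
        have : z - 3 * y - x = p + 4 * k + r := by rw [hp, hk, hr]; ring
        rw [this]
        nlinarith [sq_nonneg (p - r)]
      refine ih (z - 3 * y - x).toNat (by omega) _ _ _ (by omega) hlt (by linarith)
    by_cases hr0 : r < 0
    · apply hT
      rw [← hr]
      have hlt : 0 < x - 3 * (y - r) - (z + r) := by
        have : x - 3 * (y - r) - (z + r) = p + 2 * k + 3 * r := by rw [hp, hk, hr]; ring
        rw [this]
        exact descent_aux p k r hq' (by linarith)
      refine ih (x - 3 * (y - r) - (z + r)).toNat (by omega) _ _ _ (by omega) hlt ?_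
      rw [hr]; linear_combination hq
    by_cases hp0 : p < 0
    · apply hR
      rw [← hp]
      have hlt : 0 < x + 4 * p - 3 * (y - p) - (z + 5 * p) := by
        have : x + 4 * p - 3 * (y - p) - (z + 5 * p) = 3 * p + 2 * k + r := by
          rw [hp, hk, hr]; ring
        rw [this]
        have := descent_aux r k p (by linarith) (by linarith)
        linarith
      refine ih (x + 4 * p - 3 * (y - p) - (z + 5 * p)).toNat (by omega) _ _ _ (by omega) hlt ?_
      rw [hp]; linear_combination hq
    rcases descent_end p k r hq' (by omega) (by omega) (by omega) with ⟨a1, a2, a3⟩ | ⟨a1, a2, a3⟩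
    · have e1 : x = 1 := by omega
      have e2 : y = -1 := by omega
      have e3 : z = 1 := by omega
      subst e1 e2 e3; exact h1
    · have e1 : x = 4 := by omega
      have e2 : y = -1 := by omega
      have e3 : z = 4 := by omega
      subst e1 e2 e3; exact h2

lemma M_ne_zero (x y z : ℤ)
    (hq : 13 * (x ^ 2 + y ^ 2 + z ^ 2) + 10 * x * y - 22 * x * z + 10 * y * z = -3) :
    x - 3 * y - z ≠ 0 := by
  intro h
  have : x = 3 * y + z := by linarith
  subst this
  nlinarith [sq_nonneg (y + z), sq_nonneg (2 * y + z), sq_nonneg y, sq_nonneg (z + 13 * y)]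

/-- The set `S` is covered by finitely many right cosets of `H`. -/
def CosetSmall (H : Subgroup (GL (Fin 5) ℤ)) (S : Set (GL (Fin 5) ℤ)) : Prop :=
  ∃ F : Set (GL (Fin 5) ℤ), F.Finite ∧ ∀ g ∈ S, ∃ h ∈ H, ∃ f ∈ F, g = h * f

lemma small_fiber {H : Subgroup (GL (Fin 5) ℤ)} {S : Set (GL (Fin 5) ℤ)} {X : Type*}
    (φ : GL (Fin 5) ℤ → X) (hfin : (φ '' S).Finite)
    (h : ∀ g0 ∈ S, CosetSmall H {g | g ∈ S ∧ φ g = φ g0}) : CosetSmall H S := by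
  have h' : ∀ x ∈ φ '' S, CosetSmall H {g | g ∈ S ∧ φ g = x} := by
    rintro x ⟨g0, hg0, rfl⟩
    exact h g0 hg0
  choose! F hF using h'
  refine ⟨⋃ x ∈ φ '' S, F x, hfin.biUnion fun x hx => (hF x hx).1, ?_⟩
  intro g hg
  have hx : φ g ∈ φ '' S := ⟨g, hg, rfl⟩
  obtain ⟨k, hk, f, hf, e⟩ := (hF _ hx).2 g ⟨hg, rfl⟩
  exact ⟨k, hk, f, Set.mem_biUnion hx hf, e⟩

lemma small_move {H : Subgroup (GL (Fin 5) ℤ)} {S S' : Set (GL (Fin 5) ℤ)} (hS' : CosetSmall H S')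
    (g0 : GL (Fin 5) ℤ) (h : ∀ g ∈ S, ∃ k ∈ H, k * g * g0⁻¹ ∈ S') : CosetSmall H S := by
  obtain ⟨F, hF, hc⟩ := hS'
  refine ⟨(fun f => f * g0) '' F, hF.image _, ?_⟩
  intro g hg
  obtain ⟨k, hk, hkg⟩ := h g hg
  obtain ⟨k', hk', f, hf, e⟩ := hc _ hkg
  refine ⟨k⁻¹ * k', H.mul_mem (H.inv_mem hk) hk', f * g0, ⟨f, hf, rfl⟩, ?_⟩
  have : g = k⁻¹ * (k * g * g0⁻¹) * g0 := by group
  rw [this, e]; group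

lemma finiteIndex_of_small {H G : Subgroup (GL (Fin 5) ℤ)} (h : CosetSmall H (G : Set (GL (Fin 5) ℤ))) :
    (H.subgroupOf G).FiniteIndex := by
  obtain ⟨F, hF, hc⟩ := h
  have : Finite F := hF
  choose! k hk f hf e using hc
  have hfin : Finite (G ⧸ H.subgroupOf G) := by
    refine Finite.of_injective (β := F)
      (fun q => ⟨f ((q.out⁻¹ : G) : GL (Fin 5) ℤ), hf _ (q.out⁻¹ : G).2⟩) ?_
    intro q q' hqq
    have h1 := congrArg Subtype.val hqq
    simp only at h1
    rw [← q.out_eq, ← q'.out_eq, ← Quotient.mk''_eq_mk]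
    apply QuotientGroup.eq.2
    rw [Subgroup.mem_subgroupOf]
    have e1 := e _ (q.out⁻¹ : G).2
    have e2 := e _ (q'.out⁻¹ : G).2
    have e3 : ((q.out⁻¹ * q'.out : G) : GL (Fin 5) ℤ)
      = ((q.out⁻¹ : G) : GL (Fin 5) ℤ) * ((q'.out⁻¹ : G) : GL (Fin 5) ℤ)⁻¹ := by simp
    rw [e3, e1, e2, h1]
    have e4 : ∀ a b c : GL (Fin 5) ℤ, a * b * (c * b)⁻¹ = a * c⁻¹ := by intros; group
    rw [e4]
    exact H.mul_mem (hk _ (q.out⁻¹ : G).2) (H.inv_mem (hk _ (q'.out⁻¹ : G).2))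
  exact Subgroup.finiteIndex_of_finite_quotient

lemma exists_congr_mat {M M' : Matrix (Fin 5) (Fin 5) ℤ} {K : ℕ}
    (h : M.map (Int.cast : ℤ → ZMod K) = M'.map (Int.cast : ℤ → ZMod K)) :
    ∃ D : Matrix (Fin 5) (Fin 5) ℤ, M = M' + (K : ℤ) • D := by
  have h1 : ∀ i j, ∃ d, M i j - M' i j = (K : ℤ) * d := by
    intro i j
    have := congrFun (congrFun h i) j
    simp only [Matrix.map_apply] at this
    have h2 : ((M i j - M' i j : ℤ) : ZMod K) = 0 := by push_cast; rw [this, sub_self]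
    exact (ZMod.intCast_zmod_eq_zero_iff_dvd _ K).1 h2
  choose D hD using h1
  refine ⟨Matrix.of D, ?_⟩
  ext i j
  simp only [Matrix.add_apply, Matrix.smul_apply, Matrix.of_apply, smul_eq_mul]
  linarith [hD i j]

/-- Sum of coordinates. -/
def sm (v : Fin 5 → ℤ) : ℤ := v 0 + v 1 + v 2 + v 3 + v 4

/-- Coordinates on `e^⊥ / e`. -/
def pw (v : Fin 5 → ℤ) : ℤ × ℤ × ℤ :=
  (v 0 - v 4, v 0 + v 1 + 2 * v 4, v 0 + v 1 + v 2 - 2 * v 4)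

lemma pw_add (u v : Fin 5 → ℤ) : pw (u + v) = pw u + pw v := by
  ext <;> simp [pw] <;> ring

lemma pw_smul (n : ℤ) (v : Fin 5 → ℤ) : pw (n • v) = n • pw v := by
  ext <;> simp [pw] <;> ring

lemma pw_evec : pw evec = 0 := by decide +kernel

/-- The form on `e^⊥ / e`. -/
def bw (x y : ℤ × ℤ × ℤ) : ℤ :=
  52 * (x.1 * y.1 + x.2.1 * y.2.1 + x.2.2 * y.2.2) + 20 * (x.1 * y.2.1 + x.2.1 * y.1)
    - 44 * (x.1 * y.2.2 + x.2.2 * y.1) + 20 * (x.2.1 * y.2.2 + x.2.2 * y.2.1)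

lemma bq_expand (u v : Fin 5 → ℤ) : bq u v =
    u 0 * (37 * v 0 + 11 * v 1 - 35 * v 2 - 37 * v 3 + 37 * v 4)
    + u 1 * (11 * v 0 + 37 * v 1 + 11 * v 2 - 35 * v 3 - 37 * v 4)
    + u 2 * (-35 * v 0 + 11 * v 1 + 37 * v 2 + 11 * v 3 - 35 * v 4)
    + u 3 * (-37 * v 0 - 35 * v 1 + 11 * v 2 + 37 * v 3 + 11 * v 4)
    + u 4 * (37 * v 0 - 37 * v 1 - 35 * v 2 + 11 * v 3 + 37 * v 4) := by
  simp [bq, matQ, Matrix.mulVec, dotProduct, Fin.sum_univ_succ]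
  ring

lemma bq_evec (v : Fin 5 → ℤ) : bq evec v = 12 * sm v := by
  rw [bq_expand]
  simp [evec, sm]
  ring

lemma bq_eq_bw {u v : Fin 5 → ℤ} (hu : sm u = 0) (hv : sm v = 0) : bq u v = bw (pw u) (pw v) := by
  have h1 : u 3 = -(u 0 + u 1 + u 2 + u 4) := by unfold sm at hu; linarith
  have h2 : v 3 = -(v 0 + v 1 + v 2 + v 4) := by unfold sm at hv; linarith
  rw [bq_expand, h1, h2]
  simp only [bw, pw]
  ring

lemma decomp {v : Fin 5 → ℤ} (hv : sm v = 0) : v = (pw v).1 • ![1, -1, 0, 0, 0]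
    + (pw v).2.1 • ![0, 1, -1, 0, 0] + (pw v).2.2 • ![0, 0, 1, -1, 0] + v 4 • evec := by
  unfold sm at hv
  ext i
  fin_cases i <;> simp [pw, evec] <;> linarith

/-- The stabilizer of `evec` in the orthogonal group. -/
def Stab : Subgroup (GL (Fin 5) ℤ) where
  carrier := {g | g ∈ orthogonalSubgroup matQ ∧ (g : Matrix (Fin 5) (Fin 5) ℤ) *ᵥ evec = evec}
  one_mem' := ⟨Subgroup.one_mem _, by simp⟩
  mul_mem' := by
    rintro a b ⟨ha, ha'⟩ ⟨hb, hb'⟩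
    refine ⟨Subgroup.mul_mem _ ha hb, ?_⟩
    rw [Units.val_mul, ← Matrix.mulVec_mulVec, hb', ha']
  inv_mem' := by
    rintro a ⟨ha, ha'⟩
    refine ⟨Subgroup.inv_mem _ ha, ?_⟩
    conv_lhs => rw [← ha']
    rw [Matrix.mulVec_mulVec, Units.inv_mul, Matrix.one_mulVec]

lemma Stab.sm {g : GL (Fin 5) ℤ} (hg : g ∈ Stab) (v : Fin 5 → ℤ) :
    _root_.sm ((g : Matrix (Fin 5) (Fin 5) ℤ) *ᵥ v) = _root_.sm v := by
  have h := bq_inv hg.1 evec v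
  rw [hg.2, bq_evec, bq_evec] at h
  linarith

lemma pw_act (M : Matrix (Fin 5) (Fin 5) ℤ) {v : Fin 5 → ℤ} (hv : sm v = 0)
    (hM : M *ᵥ evec = evec) : pw (M *ᵥ v) = (pw v).1 • pw (M *ᵥ ![1, -1, 0, 0, 0])
    + (pw v).2.1 • pw (M *ᵥ ![0, 1, -1, 0, 0]) + (pw v).2.2 • pw (M *ᵥ ![0, 0, 1, -1, 0]) := by
  conv_lhs => rw [decomp hv]
  simp only [Matrix.mulVec_add, Matrix.mulVec_smul, hM, pw_add, pw_smul, pw_evec]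
  simp

/-- An element acting trivially on `e^⊥ / e` and congruent to the identity lies in `H`. -/
lemma unip_mem {H : Subgroup (GL (Fin 5) ℤ)} (hA : InH H matA) (hB : InH H matB)
    (hHG : H ≤ orthogonalSubgroup matQ)
    {k : GL (Fin 5) ℤ} (hk : k ∈ Stab)
    (hpw : ∀ v, sm v = 0 → pw ((k : Matrix (Fin 5) (Fin 5) ℤ) *ᵥ v) = pw v)
    (D : Matrix (Fin 5) (Fin 5) ℤ) (hD : (k : Matrix (Fin 5) (Fin 5) ℤ) = 1 + (KK : ℤ) • D) :
    k ∈ H := by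
  have key : ∀ v, sm v = 0 → ∃ l : ℤ,
      (k : Matrix (Fin 5) (Fin 5) ℤ) *ᵥ v = v + (KK * l) • evec := by
    intro v hv
    have h1 := Stab.sm hk v
    rw [hv] at h1
    refine ⟨(D *ᵥ v) 4, ?_⟩
    have h2 : ((k : Matrix (Fin 5) (Fin 5) ℤ) *ᵥ v) 4 = v 4 + KK * (D *ᵥ v) 4 := by
      rw [hD, Matrix.add_mulVec, Matrix.one_mulVec, Matrix.smul_mulVec]
      simp
    rw [decomp h1, hpw v hv, h2]
    generalize (D *ᵥ v) 4 = l
    conv_rhs => rw [decomp hv]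
    rw [add_smul]
    abel
  obtain ⟨l1, hl1⟩ := key ![1, 0, 0, 0, -1] (by decide +kernel)
  obtain ⟨l2, hl2⟩ := key ![0, 0, 2, 0, -2] (by decide +kernel)
  obtain ⟨l3, hl3⟩ := key ![-1, 0, 3, -6, 4] (by decide +kernel)
  obtain ⟨h, hh, he⟩ := memE hA hB (-(KK * l3)) (-(12 * 5616 ^ 2 * l2)) (-(KK * l1))
    ((dvd_neg).2 (Dvd.dvd.mul_right (by norm_num [KK]) _))
    ((dvd_neg).2 (Dvd.dvd.mul_right (by norm_num) _))
    ((dvd_neg).2 (Dvd.dvd.mul_right (by norm_num [KK]) _))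
  have hcol : ∀ x, (h : Matrix (Fin 5) (Fin 5) ℤ) *ᵥ (matP *ᵥ x) = matP *ᵥ (matE (-(KK * l3),
      -(12 * 5616 ^ 2 * l2), -(KK * l1)) *ᵥ x) := by
    intro x
    rw [Matrix.mulVec_mulVec, he, ← Matrix.mulVec_mulVec]
  have agree : ∀ a b c d : ℤ, (h : Matrix (Fin 5) (Fin 5) ℤ) *ᵥ (matP *ᵥ ![a, b, c, d, 0])
      = (k : Matrix (Fin 5) (Fin 5) ℤ) *ᵥ (matP *ᵥ ![a, b, c, d, 0]) := by
    intro a b c d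
    have e1 : matP *ᵥ ![a, b, c, d, 0] = a • evec + b • ![1, 0, 0, 0, -1] + c • ![0, 0, 2, 0, -2]
        + d • ![-1, 0, 3, -6, 4] := by
      ext i
      fin_cases i <;> simp [matP, evec, Matrix.mulVec, dotProduct, Fin.sum_univ_succ] <;> ring
    rw [hcol, matE_mulVec, e1]
    simp only [Matrix.mulVec_add, Matrix.mulVec_smul, hk.2, hl1, hl2, hl3]
    ext i
    fin_cases i <;>
      simp [matP, evec, KK, Matrix.mulVec, dotProduct, Fin.sum_univ_succ] <;> ring
  have hkG := hk.1
  have hhG := hHG hh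
  set e' : Fin 5 → ℤ := ![4, 3, 8, 3, 6] with he'
  set d : Fin 5 → ℤ := ((h⁻¹ * k : GL (Fin 5) ℤ) : Matrix (Fin 5) (Fin 5) ℤ) *ᵥ e' - e' with hd
  have hmG : h⁻¹ * k ∈ orthogonalSubgroup matQ := Subgroup.mul_mem _ (Subgroup.inv_mem _ hhG) hkG
  have fix : ∀ a b c t : ℤ, ((h⁻¹ * k : GL (Fin 5) ℤ) : Matrix (Fin 5) (Fin 5) ℤ) *ᵥ
      (matP *ᵥ ![a, b, c, t, 0]) = matP *ᵥ ![a, b, c, t, 0] := by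
    intro a b c t
    rw [Units.val_mul, ← Matrix.mulVec_mulVec, ← agree, Matrix.mulVec_mulVec, Units.inv_mul,
      Matrix.one_mulVec]
  have hme : ((h⁻¹ * k : GL (Fin 5) ℤ) : Matrix (Fin 5) (Fin 5) ℤ) *ᵥ e' = e' + d := by
    rw [hd]; abel
  have orth : ∀ a b c t : ℤ, bq (matP *ᵥ ![a, b, c, t, 0]) (e' + d)
      = bq (matP *ᵥ ![a, b, c, t, 0]) e' := by
    intro a b c t
    have := bq_inv hmG (matP *ᵥ ![a, b, c, t, 0]) e'
    rwa [fix, hme] at this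
  have hiso : bq (e' + d) (e' + d) = bq e' e' := by
    have := bq_inv hmG e' e'
    rwa [hme] at this
  have o1 := orth 1 0 0 0
  have o2 := orth 0 1 0 0
  have o3 := orth 0 0 1 0
  have o4 := orth 0 0 0 1
  rw [bq_expand, bq_expand] at o1 o2 o3 o4 hiso
  simp [matP, he', Matrix.mulVec, dotProduct, Fin.sum_univ_succ] at o1 o2 o3 o4 hiso
  have c1 : d 1 = -3 * d 4 := by linarith
  have c2 : d 2 = 4 * d 4 := by linarith
  have c3 : d 3 = -3 * d 4 := by linarith
  have c0 : d 0 = d 4 := by linarith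
  rw [c0, c1, c2, c3] at hiso
  have c4 : d 4 = 0 := by linarith
  have hd0 : d = 0 := by
    ext i
    fin_cases i <;> simp [c0, c1, c2, c3, c4]
  rw [hd0, add_zero] at hme
  have hone : ((h⁻¹ * k : GL (Fin 5) ℤ) : Matrix (Fin 5) (Fin 5) ℤ) * matP = matP := by
    have hall : ∀ x : Fin 5 → ℤ, ((h⁻¹ * k : GL (Fin 5) ℤ) : Matrix (Fin 5) (Fin 5) ℤ) *ᵥ
        (matP *ᵥ x) = matP *ᵥ x := by
      intro x
      have e1 : matP *ᵥ x = matP *ᵥ ![x 0, x 1, x 2, x 3, 0] + x 4 • e' := by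
        ext i
        fin_cases i <;>
          simp [matP, he', Matrix.mulVec, dotProduct, Fin.sum_univ_succ] <;> ring
      rw [e1, Matrix.mulVec_add, fix, Matrix.mulVec_smul, hme]
    apply Matrix.ext_of_mulVec_single
    intro i
    rw [← Matrix.mulVec_mulVec]
    exact hall _
  have h24 : (24 : ℤ) • ((h⁻¹ * k : GL (Fin 5) ℤ) : Matrix (Fin 5) (Fin 5) ℤ)
      = (24 : ℤ) • (1 : Matrix (Fin 5) (Fin 5) ℤ) := by
    have := congrArg (fun M => M * matP') hone
    simp only [mul_assoc, matP_mul] at this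
    rwa [mul_smul_comm, mul_one] at this
  have h1 : ((h⁻¹ * k : GL (Fin 5) ℤ) : Matrix (Fin 5) (Fin 5) ℤ) = 1 :=
    smul_right_injective _ (by norm_num : (24 : ℤ) ≠ 0) h24
  have h2 : h⁻¹ * k = 1 := Units.ext h1
  have h3 : k = h := (inv_mul_eq_one.1 h2).symm
  rw [h3]; exact hh

/-- Lift of the base point of the hyperbolic plane. -/
def d0 : Fin 5 → ℤ := ![1, -2, 2, -1, 0]

/-- Elements of the stabilizer which are reduced for the triangle group. -/
def Red : Set (GL (Fin 5) ℤ) :=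
  {g | g ∈ Stab ∧ ∃ x ∈ ({(1, -1, 1), (-1, 1, -1), (4, -1, 4), (-4, 1, -4)} : Set (ℤ × ℤ × ℤ)),
    pw ((g : Matrix (Fin 5) (Fin 5) ℤ) *ᵥ d0) = x}

/-- Descent predicate. -/
def Desc (H : Subgroup (GL (Fin 5) ℤ)) (x y z : ℤ) : Prop :=
  ∀ g ∈ Stab, (pw ((g : Matrix (Fin 5) (Fin 5) ℤ) *ᵥ d0) = (x, y, z) ∨
    pw ((g : Matrix (Fin 5) (Fin 5) ℤ) *ᵥ d0) = (-x, -y, -z)) → ∃ h ∈ H, h * g ∈ Red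

lemma Desc.step {H : Subgroup (GL (Fin 5) ℤ)} (hHG : H ≤ orthogonalSubgroup matQ)
    {M : Matrix (Fin 5) (Fin 5) ℤ} (hM : InH H M) (hMe : M *ᵥ evec = evec) {x y z x' y' z' : ℤ}
    (hv : x • pw (M *ᵥ ![1, -1, 0, 0, 0]) + y • pw (M *ᵥ ![0, 1, -1, 0, 0])
      + z • pw (M *ᵥ ![0, 0, 1, -1, 0]) = (x', y', z'))
    (h : Desc H x' y' z') : Desc H x y z := by
  intro g hg hx
  obtain ⟨k, hk, rfl⟩ := hM
  have hks : k ∈ Stab := ⟨hHG hk, hMe⟩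
  have h0 : sm ((g : Matrix (Fin 5) (Fin 5) ℤ) *ᵥ d0) = 0 := by
    rw [Stab.sm hg]; decide +kernel
  have hact := pw_act (k : Matrix (Fin 5) (Fin 5) ℤ) h0 hMe
  rw [Matrix.mulVec_mulVec, ← Units.val_mul] at hact
  obtain ⟨h', hh', hr⟩ := h (k * g) (Subgroup.mul_mem _ hks hg) (by
    rw [hact]
    rcases hx with hx | hx
    · left; rw [hx]; exact hv
    · right; rw [hx]
      have : ((-x', -y', -z') : ℤ × ℤ × ℤ) = -(x', y', z') := rfl
      rw [this, ← hv]
      simp only [neg_smul]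
      abel)
  exact ⟨h' * k, H.mul_mem hh' hk, by rwa [mul_assoc]⟩

lemma stab_reduce {H : Subgroup (GL (Fin 5) ℤ)} (hA : InH H matA) (hB : InH H matB)
    (hHG : H ≤ orthogonalSubgroup matQ) {g : GL (Fin 5) ℤ} (hg : g ∈ Stab) :
    ∃ h ∈ H, h * g ∈ Red := by
  obtain ⟨hR, hS, hT, -⟩ := explicit_mem hA hB
  have hdesc := descent (Desc H)
    (by
      intro g hg hx
      refine ⟨1, H.one_mem, ?_⟩
      rw [one_mul]
      refine ⟨hg, ?_⟩
      rcases hx with hx | hx <;> rw [hx] <;> simp)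
    (by
      intro g hg hx
      refine ⟨1, H.one_mem, ?_⟩
      rw [one_mul]
      refine ⟨hg, ?_⟩
      rcases hx with hx | hx <;> rw [hx] <;> simp)
    (by
      intro x y z h
      refine Desc.step hHG hS (by decide +kernel) ?_ h
      have e1 : pw (matS *ᵥ ![1, -1, 0, 0, 0]) = (0, 0, 1) := by decide +kernel
      have e2 : pw (matS *ᵥ ![0, 1, -1, 0, 0]) = (0, 1, 0) := by decide +kernel
      have e3 : pw (matS *ᵥ ![0, 0, 1, -1, 0]) = (1, 0, 0) := by decide +kernel
      rw [e1, e2, e3]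
      ext <;> simp)
    (by
      intro x y z h
      refine Desc.step hHG hT (by decide +kernel) ?_ h
      have e1 : pw (matSa *ᵥ ![1, -1, 0, 0, 0]) = (1, -2, 2) := by decide +kernel
      have e2 : pw (matSa *ᵥ ![0, 1, -1, 0, 0]) = (0, 0, 1) := by decide +kernel
      have e3 : pw (matSa *ᵥ ![0, 0, 1, -1, 0]) = (0, 1, 0) := by decide +kernel
      rw [e1, e2, e3]
      ext <;> simp <;> ring)
    (by
      intro x y z h
      refine Desc.step hHG hR (by decide +kernel) ?_ h
      have e1 : pw (matR *ᵥ ![1, -1, 0, 0, 0]) = (5, -1, 5) := by decide +kernel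
      have e2 : pw (matR *ᵥ ![0, 1, -1, 0, 0]) = (-16, 5, -20) := by decide +kernel
      have e3 : pw (matR *ᵥ ![0, 0, 1, -1, 0]) = (-8, 2, -9) := by decide +kernel
      rw [e1, e2, e3]
      ext <;> simp <;> ring)
  have h0 : sm ((g : Matrix (Fin 5) (Fin 5) ℤ) *ᵥ d0) = 0 := by
    rw [Stab.sm hg]; decide +kernel
  have hq := bq_inv hg.1 d0 d0
  rw [bq_eq_bw h0 h0] at hq
  have hd : bq d0 d0 = -12 := by decide +kernel
  rw [hd] at hq
  obtain ⟨⟨x, y, z⟩, hx⟩ : ∃ t, t = pw ((g : Matrix (Fin 5) (Fin 5) ℤ) *ᵥ d0) := ⟨_, rfl⟩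
  rw [← hx] at hq
  simp only [bw] at hq
  have hq' : 13 * (x ^ 2 + y ^ 2 + z ^ 2) + 10 * x * y - 22 * x * z + 10 * y * z = -3 := by linarith
  rcases lt_or_gt_of_ne (M_ne_zero x y z hq') with h1 | h1
  · refine hdesc (-x - 3 * -y - -z).toNat (-x) (-y) (-z) (by omega) (by omega) (by linarith) g hg ?_
    right; rw [← hx]; simp
  · exact hdesc (x - 3 * y - z).toNat x y z (by omega) (by omega) hq' g hg (Or.inl hx.symm)

lemma bound_aux (x y z : ℤ) (h : 13 * (x ^ 2 + y ^ 2 + z ^ 2) + 10 * x * y - 22 * x * z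
    + 10 * y * z = 13) (h' : x + y + z = 1 ∨ x + y + z = -1 ∨ x + 9 * y + z = 1 ∨
      x + 9 * y + z = -1) :
    (-100 ≤ x ∧ x ≤ 100) ∧ (-100 ≤ y ∧ y ≤ 100) ∧ (-100 ≤ z ∧ z ≤ 100) := by
  have hb : ∀ u v : ℤ, u ^ 2 + 3 * v ^ 2 = 4 → (-2 ≤ u ∧ u ≤ 2) ∧ (-2 ≤ v ∧ v ≤ 2) := by
    intro u v huv
    refine ⟨⟨?_, ?_⟩, ?_, ?_⟩ <;> nlinarith [sq_nonneg u, sq_nonneg v]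
  rcases h' with h1 | h1 | h1 | h1
  · obtain rfl : y = 1 - x - z := by linarith
    have := hb (x + z - 2) (x - z) (by nlinarith)
    omega
  · obtain rfl : y = -1 - x - z := by linarith
    have := hb (x + z + 2) (x - z) (by nlinarith)
    omega
  · obtain rfl : x = 1 - 9 * y - z := by linarith
    have := hb (y - 1) (1 - 9 * y - z - z) (by nlinarith)
    omega
  · obtain rfl : x = -1 - 9 * y - z := by linarith
    have := hb (y + 1) (-1 - 9 * y - z - z) (by nlinarith)
    omega

/-- A finite box. -/
def box : Set (ℤ × ℤ × ℤ) := Set.Icc (-100, -100, -100) (100, 100, 100)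

lemma red_box {g : GL (Fin 5) ℤ} (hg : g ∈ Red) (v : Fin 5 → ℤ) (hv : sm v = 0)
    (h1 : bq v v = 52) (h2 : bq v d0 = -12) : pw ((g : Matrix (Fin 5) (Fin 5) ℤ) *ᵥ v) ∈ box := by
  obtain ⟨hs, x, hx, hgx⟩ := hg
  have s1 : sm ((g : Matrix (Fin 5) (Fin 5) ℤ) *ᵥ v) = 0 := by rw [Stab.sm hs, hv]
  have s2 : sm ((g : Matrix (Fin 5) (Fin 5) ℤ) *ᵥ d0) = 0 := by
    rw [Stab.sm hs]; decide +kernel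
  have e1 := bq_inv hs.1 v v
  have e2 := bq_inv hs.1 v d0
  rw [bq_eq_bw s1 s1, h1] at e1
  rw [bq_eq_bw s1 s2, h2, hgx] at e2
  generalize pw ((g : Matrix (Fin 5) (Fin 5) ℤ) *ᵥ v) = t at e1 e2 ⊢
  obtain ⟨a, b, c⟩ := t
  simp only [bw] at e1 e2
  have hb := bound_aux a b c (by linarith) (by
    simp only [Set.mem_insert_iff, Set.mem_singleton_iff] at hx
    rcases hx with rfl | rfl | rfl | rfl <;> simp only at e2 <;> omega)
  exact ⟨⟨hb.1.1, hb.2.1.1, hb.2.2.1⟩, ⟨hb.1.2, hb.2.1.2, hb.2.2.2⟩⟩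

lemma quot_congr {g g0 : GL (Fin 5) ℤ} {D : Matrix (Fin 5) (Fin 5) ℤ} {K : ℤ}
    (h : (g : Matrix (Fin 5) (Fin 5) ℤ) = (g0 : Matrix (Fin 5) (Fin 5) ℤ) + K • D) :
    ((g * g0⁻¹ : GL (Fin 5) ℤ) : Matrix (Fin 5) (Fin 5) ℤ)
      = 1 + K • (D * ((g0⁻¹ : GL (Fin 5) ℤ) : Matrix (Fin 5) (Fin 5) ℤ)) := by
  rw [Units.val_mul, h, add_mul, Units.mul_inv, smul_mul_assoc]

instance : NeZero KK := ⟨by norm_num [KK]⟩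

lemma red_small {H : Subgroup (GL (Fin 5) ℤ)} (hA : InH H matA) (hB : InH H matB)
    (hHG : H ≤ orthogonalSubgroup matQ) : CosetSmall H Red := by
  refine small_fiber (fun g : GL (Fin 5) ℤ =>
    ((pw ((g : Matrix (Fin 5) (Fin 5) ℤ) *ᵥ ![1, -1, 0, 0, 0]),
      pw ((g : Matrix (Fin 5) (Fin 5) ℤ) *ᵥ ![0, 1, -1, 0, 0]),
      pw ((g : Matrix (Fin 5) (Fin 5) ℤ) *ᵥ ![0, 0, 1, -1, 0])),
      (g : Matrix (Fin 5) (Fin 5) ℤ).map (Int.cast : ℤ → ZMod KK))) ?_ ?_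
  · have hbox : box.Finite := Set.finite_Icc _ _
    refine Set.Finite.subset ((hbox.prod (hbox.prod hbox)).prod
      (Set.finite_univ (α := Matrix (Fin 5) (Fin 5) (ZMod KK)))) ?_
    rintro _ ⟨g, hg, rfl⟩
    refine ⟨⟨?_, ?_, ?_⟩, Set.mem_univ _⟩
    · exact red_box hg _ (by decide +kernel) (by decide +kernel) (by decide +kernel)
    · exact red_box hg _ (by decide +kernel) (by decide +kernel) (by decide +kernel)
    · exact red_box hg _ (by decide +kernel) (by decide +kernel) (by decide +kernel)
  · intro g0 hg0
    refine ⟨{g0}, Set.finite_singleton _, ?_⟩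
    rintro g ⟨hg, he⟩
    refine ⟨g * g0⁻¹, ?_, g0, rfl, by group⟩
    simp only [Prod.mk.injEq] at he
    obtain ⟨⟨a1, a2, a3⟩, a4⟩ := he
    obtain ⟨D, hD⟩ := exists_congr_mat a4
    refine unip_mem hA hB hHG (Subgroup.mul_mem _ hg.1 (Subgroup.inv_mem _ hg0.1)) ?_ _
      (quot_congr hD)
    intro v hv
    set v' := ((g0⁻¹ : GL (Fin 5) ℤ) : Matrix (Fin 5) (Fin 5) ℤ) *ᵥ v with hv'
    have hs : sm v' = 0 := by rw [hv', Stab.sm (Subgroup.inv_mem _ hg0.1), hv]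
    have e1 : v = (g0 : Matrix (Fin 5) (Fin 5) ℤ) *ᵥ v' := by
      rw [hv', Matrix.mulVec_mulVec, Units.mul_inv, Matrix.one_mulVec]
    rw [Units.val_mul, ← Matrix.mulVec_mulVec, ← hv', pw_act _ hs hg.1.2, a1, a2, a3,
      ← pw_act _ hs hg0.1.2, ← e1]

lemma stab_small {H : Subgroup (GL (Fin 5) ℤ)} (hA : InH H matA) (hB : InH H matB)
    (hHG : H ≤ orthogonalSubgroup matQ) : CosetSmall H (Stab : Set (GL (Fin 5) ℤ)) := by
  refine small_move (red_small hA hB hHG) 1 ?_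
  intro g hg
  obtain ⟨h, hh, hr⟩ := stab_reduce hA hB hHG hg
  exact ⟨h, hh, by simpa using hr⟩

lemma all_small {H : Subgroup (GL (Fin 5) ℤ)} (hA : InH H matA) (hB : InH H matB)
    (hHG : H ≤ orthogonalSubgroup matQ) :
    CosetSmall H (orthogonalSubgroup matQ : Set (GL (Fin 5) ℤ)) := by
  refine small_fiber (fun g : GL (Fin 5) ℤ =>
      (g : Matrix (Fin 5) (Fin 5) ℤ).map (Int.cast : ℤ → ZMod KK)) (Set.toFinite _) ?_
  intro g0 hg0
  refine small_move (stab_small hA hB hHG) g0 ?_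
  rintro g ⟨hg, he⟩
  obtain ⟨D, hD⟩ := exists_congr_mat he
  have hq := Subgroup.mul_mem _ hg (Subgroup.inv_mem _ hg0)
  obtain ⟨h, hh, e⟩ := congr_reach hA hB hq _ (quot_congr hD)
  refine ⟨h, hh, ?_⟩
  rw [mul_assoc]
  exact ⟨Subgroup.mul_mem _ (hHG hh) hq, e⟩

/-- Case 5 of Theorem 1.2: the hypergeometric group `Γ(f,g)` generated by the companion matrices `A`, `B`
of `f(x) = x^5 - 4*x^4 + 7*x^3 - 7*x^2 + 4*x - 1` and `g(x) = x^5 + x^4 + 2*x^3 + 2*x^2 + x + 1`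
is an arithmetic subgroup of `O_Q(ℤ)`: it preserves `Q`, it is contained in `O_Q(ℤ)`,
and it has finite index in `O_Q(ℤ)`. -/
theorem hypergeometric_group_arithmetic
    (A B : GL (Fin 5) ℤ)
    (hA : (A : Matrix (Fin 5) (Fin 5) ℤ) = matA)
    (hB : (B : Matrix (Fin 5) (Fin 5) ℤ) = matB) :
    matAᵀ * matQ * matA = matQ ∧
    matBᵀ * matQ * matB = matQ ∧
    Subgroup.closure {A, B} ≤ orthogonalSubgroup matQ ∧
    ((Subgroup.closure {A, B}).subgroupOf (orthogonalSubgroup matQ)).FiniteIndex := by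
  have h1 : matAᵀ * matQ * matA = matQ := by decide +kernel
  have h2 : matBᵀ * matQ * matB = matQ := by decide +kernel
  have h3 : Subgroup.closure {A, B} ≤ orthogonalSubgroup matQ := by
    rw [Subgroup.closure_le]
    rintro g (rfl | rfl)
    · change (g : Matrix (Fin 5) (Fin 5) ℤ)ᵀ * matQ * (g : Matrix (Fin 5) (Fin 5) ℤ) = matQ
      rw [hA, h1]
    · change (g : Matrix (Fin 5) (Fin 5) ℤ)ᵀ * matQ * (g : Matrix (Fin 5) (Fin 5) ℤ) = matQ
      rw [hB, h2]
  refine ⟨h1, h2, h3, finiteIndex_of_small (all_small ?_ ?_ h3)⟩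
  · exact ⟨A, Subgroup.subset_closure (by simp), hA⟩
  · exact ⟨B, Subgroup.subset_closure (by simp), hB⟩
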